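/- arXiv:1804.00187 — 2 statements merged into one kernel-verified Lean document; each statement's English description precedes it below -/
import Mathlib

section
/- Let (λ_n) and (λ̃_k) be nonincreasing summable sequences of positive reals with counting functions N, Ñ satisfying N(t) ~ φ(1/t)·s(ln(1/t))/t^{1/p} and Ñ(t) ~ φ̃(1/t)·s̃(ln(1/t))/t^{1/p} as t → 0+, where p > 0, φ, φ̃ are C¹ SVFs with ∫_1^∞ φ(τ) dτ/τ = ∫_1^∞ φ̃(τ) dτ/τ = ∞, and s, s̃ are continuous, bounded, separated-from-zero periodic functions of the form s(τ) = e^{−τ/p}ρ(τ), s̃(τ) = e^{−τ/p}ρ̃(τ) with ρ, ρ̃ monotone continuous, whose periods T and T̃ are incommensurable. Assume in addition there is a constant C such that |σ·ln(σ)·φ'(σ)/φ(σ)| ≤ C and |σ·ln(σ)·φ̃'(σ)/φ̃(σ)| ≤ C for all σ ≥ 1. Then N_⊗(t) ~ 𝔠·(φ∗φ̃)(1/t)/t^{1/p} as t → 0+, where 𝔠 = (1/p)·((1/T)∫_0^T s(t) dt)·((1/T̃)∫_0^{T̃} s̃(t) dt). -/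
open MeasureTheory Filter Real Set Asymptotics

noncomputable section

/-- A function is *slowly varying at infinity* (SVF): it is positive on `(0, ∞)` and
`φ(cτ)/φ(τ) → 1` as `τ → ∞` for every constant `c > 0`. -/
def IsSVF (φ : ℝ → ℝ) : Prop :=
  (∀ x > 0, 0 < φ x) ∧ ∀ c > 0, Tendsto (fun τ => φ (c * τ) / φ τ) atTop (nhds 1)

/-- Mellin convolution `(φ∗ψ)(τ) = ∫_1^τ φ(σ) ψ(τ/σ) dσ/σ`. -/
def mellinConv (φ ψ : ℝ → ℝ) (τ : ℝ) : ℝ :=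
  ∫ σ in Set.Ioc (1:ℝ) τ, φ σ * ψ (τ / σ) / σ

/-- `h_{φ,ψ}(τ) = ∫_1^{√τ} φ(σ) ψ(τ/σ) dσ/σ`. -/
def mellinH (φ ψ : ℝ → ℝ) (τ : ℝ) : ℝ :=
  ∫ σ in Set.Ioc (1:ℝ) (Real.sqrt τ), φ σ * ψ (τ / σ) / σ

/-- `μ` is the Lebesgue–Stieltjes measure generated by the (monotone) function
`σ ↦ ρ (ln σ)` on `(0, ∞)`. -/
def IsLogStieltjes (μ : MeasureTheory.Measure ℝ) (ρ : ℝ → ℝ) : Prop :=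
  ∀ a b : ℝ, 0 < a → a ≤ b →
    μ (Set.Ioc a b) = ENNReal.ofReal (ρ (Real.log b) - ρ (Real.log a))

/-- `ν` is the Lebesgue–Stieltjes measure generated by the (monotone) function `ρ`. -/
def IsStieltjesOf (ν : MeasureTheory.Measure ℝ) (ρ : ℝ → ℝ) : Prop :=
  ∀ a b : ℝ, a ≤ b → ν (Set.Ioc a b) = ENNReal.ofReal (ρ b - ρ a)

/-- The almost Mellin convolution integral
`∫_A φ(τ/σ) ψ(σ) s(ln(τ/σ)) s̃(ln σ) d(ρ̃(ln σ))/ρ̃(ln σ)` over a region `A`,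
where `μ` is the Lebesgue–Stieltjes measure of `σ ↦ ρ̃(ln σ)`. -/
def almostMellinOn (A : Set ℝ) (φ ψ s st ρt : ℝ → ℝ) (μ : MeasureTheory.Measure ℝ)
    (τ : ℝ) : ℝ :=
  ∫ σ in A, φ (τ / σ) * ψ σ * s (Real.log (τ / σ)) * st (Real.log σ) / ρt (Real.log σ) ∂μ

/-- `(φs ∗ ψs̃)(τ)`: the almost Mellin convolution over `(1, τ]`. -/
def almostMellin (φ ψ s st ρt : ℝ → ℝ) (μ : MeasureTheory.Measure ℝ) (τ : ℝ) : ℝ :=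
  almostMellinOn (Set.Ioc 1 τ) φ ψ s st ρt μ τ

/-- `H[φs, ψs̃](τ)`: the almost Mellin convolution over `(1, √τ]`. -/
def almostH (φ ψ s st ρt : ℝ → ℝ) (μ : MeasureTheory.Measure ℝ) (τ : ℝ) : ℝ :=
  almostMellinOn (Set.Ioc 1 (Real.sqrt τ)) φ ψ s st ρt μ τ

/-- `H₁[φs, ψs̃](τ)`: the almost Mellin convolution over `(√τ, τ]`. -/
def almostH1 (φ ψ s st ρt : ℝ → ℝ) (μ : MeasureTheory.Measure ℝ) (τ : ℝ) : ℝ :=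
  almostMellinOn (Set.Ioc (Real.sqrt τ) τ) φ ψ s st ρt μ τ

/-- `(s ⋆ s̃)(η) = (1/T) ∫_0^T s(η − λ) s̃(λ) dλ`. -/
def periodConv (s st : ℝ → ℝ) (T η : ℝ) : ℝ :=
  (1 / T) * ∫ l in (0:ℝ)..T, s (η - l) * st l

/-- The eigenvalue counting function `N(t) = #{n : λ_n > t}` of a sequence. -/
def cntF (lam : ℕ → ℝ) (t : ℝ) : ℝ := (Nat.card {n : ℕ | t < lam n} : ℝ)

/-- The counting function `N_⊗(t) = #{(k, j) : λ_k λ̃_j > t}` of the tensor product. -/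
def cntTensor (lam lamt : ℕ → ℝ) (t : ℝ) : ℝ :=
  (Nat.card {q : ℕ × ℕ | t < lam q.1 * lamt q.2} : ℝ)

/-- `s_⊗(η) = (1/p)(s ⋆ s̃)(η) + (s ⋆ s̃)'(η)`. -/
def sOtimes (p T : ℝ) (s st : ℝ → ℝ) (η : ℝ) : ℝ :=
  (1 / p) * periodConv s st T η + deriv (periodConv s st T) η

/-- `m_ψ(σ) = sup_{τ > σ²} ψ(τ/σ)/ψ(τ)`. -/
def mSup (ψ : ℝ → ℝ) (σ : ℝ) : ℝ :=
  sSup {r : ℝ | ∃ τ : ℝ, σ ^ 2 < τ ∧ r = ψ (τ / σ) / ψ τ}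

theorem exists_bound_integral_sub_mean {s : ℝ → ℝ} {T : ℝ} (hT : 0 < T) (hs : Continuous s)
    (hper : Function.Periodic s T) :
    ∃ K, ∀ u v, |∫ w in u..v, (s w - (1 / T) * ∫ x in (0:ℝ)..T, s x)| ≤ K := by
  set c := (1 / T) * ∫ x in (0:ℝ)..T, s x with hc
  have hii : ∀ u v, IntervalIntegrable (fun w => s w - c) volume u v :=
    fun u v => (hs.sub continuous_const).intervalIntegrable u v
  set H : ℝ → ℝ := fun v => ∫ w in (0:ℝ)..v, (s w - c) with hH
  have hHc : Continuous H := intervalIntegral.continuous_primitive hii 0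
  have hHper : Function.Periodic H T := by
    intro v
    have h1 : (∫ w in (0:ℝ)..v, (s w - c)) + ∫ w in v..(v + T), (s w - c)
        = ∫ w in (0:ℝ)..(v + T), (s w - c) :=
      intervalIntegral.integral_add_adjacent_intervals (hii _ _) (hii _ _)
    have hp : Function.Periodic (fun w => s w - c) T := fun w => by simp only [hper w]
    have h2 : ∫ w in v..(v + T), (s w - c) = ∫ w in (0:ℝ)..(0 + T), (s w - c) :=
      hp.intervalIntegral_add_eq v 0
    have h3 : ∫ w in (0:ℝ)..(0 + T), (s w - c) = 0 := by
      rw [intervalIntegral.integral_sub (hs.intervalIntegrable _ _)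
        (continuous_const.intervalIntegrable _ _), intervalIntegral.integral_const]
      simp only [zero_add, sub_zero, smul_eq_mul, hc]
      field_simp
      ring
    simp only [hH]
    rw [← h1, h2, h3, add_zero]
  obtain ⟨K, hK⟩ := (hHper.compact_of_continuous hT.ne' hHc).isBounded.exists_norm_le
  refine ⟨K + K, fun u v => ?_⟩
  have h1 : ∫ w in u..v, (s w - c) = H v - H u := by
    simp only [hH]
    rw [intervalIntegral.integral_interval_sub_left (hii _ _) (hii _ _)]
  rw [h1]
  calc |H v - H u| ≤ |H v| + |H u| := abs_sub _ _
    _ ≤ K + K := add_le_add (hK _ ⟨v, rfl⟩) (hK _ ⟨u, rfl⟩)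

theorem exists_bound_integral_mul_exp {s : ℝ → ℝ} {T M : ℝ} {c : ℂ} (hT : 0 < T)
    (hs : Continuous s) (hper : Function.Periodic s T) (hM : ∀ x, |s x| ≤ M)
    (hre : c.re = 0) (hc : Complex.exp (c * T) ≠ 1) :
    ∃ K, ∀ u v : ℝ, ‖∫ w in u..v, (s w : ℂ) * Complex.exp (c * w)‖ ≤ K := by
  set k : ℝ → ℂ := fun w => (s w : ℂ) * Complex.exp (c * w) with hk
  have hkc : Continuous k := by fun_prop
  have hii : ∀ u v, IntervalIntegrable k volume u v := fun u v => hkc.intervalIntegrable u v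
  have hkM : ∀ w, ‖k w‖ ≤ M := fun w => by
    simp only [hk, norm_mul, Complex.norm_real, Complex.norm_exp, Complex.mul_re,
      Complex.ofReal_re, Complex.ofReal_im, hre]
    simpa using hM w
  have hshift : ∀ w, k (w + T) = Complex.exp (c * T) * k w := fun w => by
    simp only [hk, hper w, Complex.ofReal_add, mul_add, Complex.exp_add]
    ring
  have hpos : 0 < ‖Complex.exp (c * T) - 1‖ := norm_pos_iff.2 (sub_ne_zero.2 hc)
  refine ⟨(M * T + M * T) / ‖Complex.exp (c * T) - 1‖, fun u v => ?_⟩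
  rw [le_div_iff₀ hpos, ← norm_mul]
  have h1 : ∫ w in (u + T)..(v + T), k w = Complex.exp (c * T) * ∫ w in u..v, k w := by
    rw [← intervalIntegral.integral_comp_add_right, ← intervalIntegral.integral_const_mul]
    simp only [hshift]
  have h2 : (∫ w in u..v, k w) * (Complex.exp (c * T) - 1)
      = (∫ w in v..(v + T), k w) - ∫ w in u..(u + T), k w := by
    have e1 := intervalIntegral.integral_add_adjacent_intervals (hii u (u + T)) (hii (u + T) (v + T))
    have e2 := intervalIntegral.integral_add_adjacent_intervals (hii u v) (hii v (v + T))
    rw [h1] at e1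
    linear_combination e1 - e2
  have h3 : ∀ u, ‖∫ w in u..(u + T), k w‖ ≤ M * T := fun u => by
    have := intervalIntegral.norm_integral_le_of_norm_le_const (a := u) (b := u + T) (f := k)
      (C := M) (fun x _ => hkM x)
    simpa [abs_of_pos hT] using this
  rw [h2]
  exact (norm_sub_le _ _).trans (add_le_add (h3 v) (h3 u))

theorem integral_fourier_period {T : ℝ} (hT : 0 < T) {m : ℤ} (hm : m ≠ 0) :
    ∫ x in (0:ℝ)..T, (fourier m (x : AddCircle T) : ℂ) = 0 := by
  have hne : (2 * π * Complex.I * m / T : ℂ) ≠ 0 := by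
    have : (T : ℂ) ≠ 0 := by exact_mod_cast hT.ne'
    have : (π : ℂ) ≠ 0 := by exact_mod_cast Real.pi_ne_zero
    have : (m : ℂ) ≠ 0 := by exact_mod_cast hm
    simp_all
  have h1 : ∀ x : ℝ, (fourier m (x : AddCircle T) : ℂ)
      = Complex.exp ((2 * π * Complex.I * m / T) * x) := fun x => by
    rw [fourier_coe_apply]; congr 1; ring
  simp only [h1]
  rw [integral_exp_mul_complex hne]
  have : (2 * π * Complex.I * m / T : ℂ) * T = m * (2 * π * Complex.I) := by
    have : (T : ℂ) ≠ 0 := by exact_mod_cast hT.ne'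
    field_simp
  rw [this, Complex.exp_int_mul_two_pi_mul_I]
  simp

/-- Equidistribution of the flow `w ↦ (w, x - w)` on the torus with incommensurable periods,
uniformly in the starting point, in complex form. -/
theorem exists_bound_integral_mul_circle {s : ℝ → ℝ} {T Tt M : ℝ} (hT : 0 < T) [Fact (0 < Tt)]
    (hs : Continuous s) (hper : Function.Periodic s T) (hM : ∀ x, |s x| ≤ M)
    (hirr : Irrational (T / Tt)) (h : C(AddCircle Tt, ℂ)) {ε : ℝ} (hε : 0 < ε) :
    ∃ K, ∀ x u v : ℝ, u ≤ v →
      ‖∫ w in u..v, (s w : ℂ) * (h ((x - w : ℝ) : AddCircle Tt)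
        - (1 / Tt : ℂ) * ∫ y in (0:ℝ)..Tt, h (y : AddCircle Tt))‖ ≤ ε * (v - u) + K := by
  have hTt : 0 < Tt := Fact.out
  have hM0 : 0 ≤ M := (abs_nonneg _).trans (hM 0)
  have hcirc : Continuous (fun y : ℝ => (y : AddCircle Tt)) := AddCircle.continuous_mk' Tt
  have hii : ∀ (g : C(AddCircle Tt, ℂ)) (c : ℂ) (x u v : ℝ), IntervalIntegrable
      (fun w : ℝ => (s w : ℂ) * (g ((x - w : ℝ) : AddCircle Tt) - c)) volume u v := by
    intro g c x u v
    have h1 : Continuous (fun w : ℝ => g ((x - w : ℝ) : AddCircle Tt)) :=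
      g.continuous.comp (hcirc.comp (by fun_prop))
    exact Continuous.intervalIntegrable (by fun_prop) u v
  have hintm : ∀ (g : C(AddCircle Tt, ℂ)) (u v : ℝ), IntervalIntegrable
      (fun y : ℝ => g (y : AddCircle Tt)) volume u v := fun g u v =>
    (g.continuous.comp hcirc).intervalIntegrable u v
  set mean : C(AddCircle Tt, ℂ) → ℂ := fun g =>
    (1 / Tt : ℂ) * ∫ y in (0:ℝ)..Tt, g (y : AddCircle Tt) with hmean
  set I : C(AddCircle Tt, ℂ) → ℝ → ℝ → ℝ → ℂ := fun g x u v =>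
    ∫ w in u..v, (s w : ℂ) * (g ((x - w : ℝ) : AddCircle Tt) - mean g) with hI
  have hbdd : ∀ g ∈ Submodule.span ℂ (Set.range (@fourier Tt)),
      ∃ K, ∀ x u v : ℝ, ‖I g x u v‖ ≤ K := by
    intro g hg
    induction hg using Submodule.span_induction with
    | mem g hg =>
      obtain ⟨m, rfl⟩ := hg
      by_cases hm : m = 0
      · subst hm
        refine ⟨0, fun x u v => ?_⟩
        have : (Tt : ℂ) ≠ 0 := by exact_mod_cast hTt.ne'
        simp [hI, hmean, this]
      · have hm0 : mean (fourier m) = 0 := by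
          simp only [hmean, integral_fourier_period hTt hm, mul_zero]
        set c : ℂ := -(2 * π * m / Tt : ℝ) * Complex.I with hc
        have hc1 : Complex.exp (c * T) ≠ 1 := by
          intro h1
          obtain ⟨n, hn⟩ := Complex.exp_eq_one_iff.1 h1
          have h2 : ((-(2 * π * m / Tt) * T : ℝ) : ℂ) * Complex.I
              = ((n * (2 * π) : ℝ) : ℂ) * Complex.I := by
            rw [hc] at hn
            push_cast at hn ⊢
            linear_combination hn
          have h3 := mul_right_cancel₀ Complex.I_ne_zero h2
          have h4 : -(2 * π * m / Tt) * T = n * (2 * π) := by exact_mod_cast h3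
          have hmR : (m : ℝ) ≠ 0 := by exact_mod_cast hm
          have h5 : T / Tt = ((-n / m : ℚ) : ℝ) := by
            push_cast
            have hpi := Real.pi_ne_zero
            field_simp at h4 ⊢
            linear_combination -h4
          exact hirr ⟨_, h5.symm⟩
        obtain ⟨K, hK⟩ := exists_bound_integral_mul_exp hT hs hper hM
          (c := c) (by simp [hc]) hc1
        refine ⟨K, fun x u v => ?_⟩
        have e : ∀ w : ℝ, (s w : ℂ) * (fourier m ((x - w : ℝ) : AddCircle Tt) - mean (fourier m))
            = Complex.exp (2 * π * Complex.I * m * x / Tt) *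
              ((s w : ℂ) * Complex.exp (c * w)) := fun w => by
          rw [hm0, sub_zero, fourier_coe_apply]
          have : (2 * π * Complex.I * m * ((x - w : ℝ) : ℂ) / Tt : ℂ)
              = 2 * π * Complex.I * m * x / Tt + c * w := by
            rw [hc]; push_cast; ring
          rw [this, Complex.exp_add]; ring
        simp only [hI, e]
        rw [intervalIntegral.integral_const_mul, norm_mul]
        have : ‖Complex.exp (2 * π * Complex.I * m * x / Tt)‖ = 1 := by
          have : (2 * π * Complex.I * m * x / Tt : ℂ)
            = ((2 * π * m * x / Tt : ℝ) : ℂ) * Complex.I := by push_cast; ring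
          rw [this, Complex.norm_exp_ofReal_mul_I]
        rw [this, one_mul]
        exact hK u v
    | zero => exact ⟨0, fun x u v => by simp [hI, hmean]⟩
    | add g₁ g₂ _ _ h₁ h₂ =>
      obtain ⟨K₁, hK₁⟩ := h₁
      obtain ⟨K₂, hK₂⟩ := h₂
      refine ⟨K₁ + K₂, fun x u v => ?_⟩
      have hm : mean (g₁ + g₂) = mean g₁ + mean g₂ := by
        simp only [hmean, ContinuousMap.add_apply]
        rw [intervalIntegral.integral_add (hintm _ _ _) (hintm _ _ _), mul_add]
      have : I (g₁ + g₂) x u v = I g₁ x u v + I g₂ x u v := by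
        simp only [hI]
        rw [← intervalIntegral.integral_add (hii _ _ _ _ _) (hii _ _ _ _ _)]
        congr 1; ext w
        rw [hm, ContinuousMap.add_apply]; ring
      rw [this]
      exact (norm_add_le _ _).trans (add_le_add (hK₁ x u v) (hK₂ x u v))
    | smul z g _ h₁ =>
      obtain ⟨K₁, hK₁⟩ := h₁
      refine ⟨‖z‖ * K₁, fun x u v => ?_⟩
      have hm : mean (z • g) = z * mean g := by
        simp only [hmean, ContinuousMap.smul_apply, smul_eq_mul]
        rw [intervalIntegral.integral_const_mul]; ring
      have : I (z • g) x u v = z * I g x u v := by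
        simp only [hI]
        rw [← intervalIntegral.integral_const_mul]
        congr 1; ext w
        rw [hm, ContinuousMap.smul_apply, smul_eq_mul]; ring
      rw [this, norm_mul]
      exact mul_le_mul_of_nonneg_left (hK₁ x u v) (norm_nonneg _)
  have hdense : h ∈ closure (Submodule.span ℂ (Set.range (@fourier Tt)) : Set C(AddCircle Tt, ℂ)) := by
    rw [← Submodule.topologicalClosure_coe, span_fourier_closure_eq_top]
    trivial
  set η := ε / (2 * M + 1) with hη
  have hηpos : 0 < η := by positivity
  obtain ⟨g, hg, hgd⟩ := Metric.mem_closure_iff.1 hdense η hηpos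
  obtain ⟨K, hK⟩ := hbdd g hg
  refine ⟨K, fun x u v huv => ?_⟩
  have hpt : ∀ y, ‖h y - g y‖ ≤ η := fun y => by
    rw [← dist_eq_norm]
    exact (ContinuousMap.dist_apply_le_dist y).trans hgd.le
  have hmd : ‖mean h - mean g‖ ≤ η := by
    simp only [hmean]
    rw [← mul_sub, ← intervalIntegral.integral_sub (hintm _ _ _) (hintm _ _ _), norm_mul]
    have h1 := intervalIntegral.norm_integral_le_of_norm_le_const (a := 0) (b := Tt)
      (f := fun y : ℝ => h (y : AddCircle Tt) - g (y : AddCircle Tt))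
      (C := η) (fun x _ => hpt x)
    have h2 : ‖(1 / Tt : ℂ)‖ = 1 / Tt := by simp [abs_of_pos hTt]
    rw [h2]
    rw [sub_zero, abs_of_pos hTt] at h1
    calc _ ≤ 1 / Tt * (η * Tt) := mul_le_mul_of_nonneg_left h1 (by positivity)
      _ = η := by field_simp
  have hdiff : ‖I h x u v - I g x u v‖ ≤ ε * (v - u) := by
    simp only [hI]
    rw [← intervalIntegral.integral_sub (hii _ _ _ _ _) (hii _ _ _ _ _)]
    have h1 : ∀ w : ℝ, ‖(s w : ℂ) * (h ((x - w : ℝ) : AddCircle Tt) - mean h)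
        - (s w : ℂ) * (g ((x - w : ℝ) : AddCircle Tt) - mean g)‖ ≤ M * (η + η) := fun w => by
      rw [← mul_sub, norm_mul, Complex.norm_real]
      refine mul_le_mul (hM w) ?_ (norm_nonneg _) hM0
      rw [sub_sub_sub_comm]
      exact (norm_sub_le _ _).trans (add_le_add (hpt _) hmd)
    refine (intervalIntegral.norm_integral_le_of_norm_le_const (fun w _ => h1 w)).trans ?_
    rw [abs_of_nonneg (sub_nonneg.2 huv)]
    refine mul_le_mul_of_nonneg_right ?_ (sub_nonneg.2 huv)
    have : ε = η * (2 * M + 1) := by rw [hη]; field_simp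
    rw [this]; nlinarith
  calc ‖I h x u v‖ = ‖(I h x u v - I g x u v) + I g x u v‖ := by rw [sub_add_cancel]
    _ ≤ ε * (v - u) + K := (norm_add_le _ _).trans (add_le_add hdiff (hK x u v))

/-- Equidistribution of the flow `w ↦ (w, x - w)` on the torus with incommensurable periods,
uniformly in the starting point. -/
theorem exists_bound_integral_mul_sub_mean {s st : ℝ → ℝ} {T Tt M : ℝ} (hT : 0 < T)
    (hTt : 0 < Tt) (hs : Continuous s) (hst : Continuous st) (hper : Function.Periodic s T)
    (hpert : Function.Periodic st Tt) (hM : ∀ x, |s x| ≤ M)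
    (hirr : Irrational (T / Tt)) {ε : ℝ} (hε : 0 < ε) :
    ∃ K, ∀ x u v : ℝ, u ≤ v →
      |∫ w in u..v, (s w * st (x - w) - ((1 / T) * ∫ y in (0:ℝ)..T, s y) *
        ((1 / Tt) * ∫ y in (0:ℝ)..Tt, st y))| ≤ ε * (v - u) + K := by
  have : Fact (0 < Tt) := ⟨hTt⟩
  set ms := (1 / T) * ∫ y in (0:ℝ)..T, s y with hms
  set mt := (1 / Tt) * ∫ y in (0:ℝ)..Tt, st y with hmt
  have hlc : Continuous hpert.lift := continuous_coinduced_dom.2 hst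
  let h : C(AddCircle Tt, ℂ) := ⟨fun y => (hpert.lift y : ℂ), Complex.continuous_ofReal.comp hlc⟩
  have hh : ∀ y : ℝ, h (y : AddCircle Tt) = st y := fun y => by
    change ((hpert.lift (y : AddCircle Tt) : ℝ) : ℂ) = st y
    rw [hpert.lift_coe]
  obtain ⟨K₁, hK₁⟩ := exists_bound_integral_mul_circle hT hs hper hM hirr h hε
  obtain ⟨K₂, hK₂⟩ := exists_bound_integral_sub_mean hT hs hper
  refine ⟨K₁ + |mt| * K₂, fun x u v huv => ?_⟩
  have h1 := hK₁ x u v huv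
  have e1 : (1 / Tt : ℂ) * ∫ y in (0:ℝ)..Tt, h (y : AddCircle Tt) = (mt : ℂ) := by
    simp only [hh, hmt]
    rw [intervalIntegral.integral_ofReal]
    push_cast; rfl
  rw [e1] at h1
  simp only [hh] at h1
  have e2 : ∀ w : ℝ, (s w : ℂ) * ((st (x - w) : ℂ) - mt)
      = ((s w * (st (x - w) - mt) : ℝ) : ℂ) := fun w => by push_cast; rfl
  simp only [e2] at h1
  rw [intervalIntegral.integral_ofReal, Complex.norm_real, Real.norm_eq_abs] at h1
  have e3 : ∫ w in u..v, (s w * st (x - w) - ms * mt)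
      = (∫ w in u..v, s w * (st (x - w) - mt)) + mt * ∫ w in u..v, (s w - ms) := by
    rw [← intervalIntegral.integral_const_mul, ← intervalIntegral.integral_add]
    · congr 1; ext w; ring
    · exact Continuous.intervalIntegrable (by fun_prop) _ _
    · exact Continuous.intervalIntegrable (by fun_prop) _ _
  rw [e3]
  have h2 : |mt * ∫ w in u..v, (s w - ms)| ≤ |mt| * K₂ := by
    rw [abs_mul]
    exact mul_le_mul_of_nonneg_left (hK₂ u v) (abs_nonneg _)
  linarith [abs_add_le (∫ w in u..v, s w * (st (x - w) - mt)) (mt * ∫ w in u..v, (s w - ms))]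

/-- If `|v W'(v)| ≤ C W(v)` on `[0, B]`, then `B W(B)` is controlled by the integral of `W`. -/
theorem mul_le_integral_of_abs_mul_deriv_le {W W' : ℝ → ℝ} {B C : ℝ} (hB : 0 ≤ B)
    (hW : ∀ v, HasDerivAt W (W' v) v) (hW' : Continuous W')
    (hb : ∀ v ∈ Icc 0 B, |v * W' v| ≤ C * W v) :
    B * W B ≤ (1 + C) * ∫ v in (0:ℝ)..B, W v := by
  have hWc : Continuous W := continuous_iff_continuousAt.2 fun v => (hW v).continuousAt
  have h1 : ∫ v in (0:ℝ)..B, (1 * W v + v * W' v) = B * W B - 0 * W 0 :=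
    intervalIntegral.integral_eq_sub_of_hasDerivAt (f := fun v => v * W v)
      (fun v _ => (hasDerivAt_id v).mul (hW v))
      (Continuous.intervalIntegrable (by fun_prop) _ _)
  rw [zero_mul, sub_zero] at h1
  rw [← h1, ← intervalIntegral.integral_const_mul]
  refine intervalIntegral.integral_mono_on hB (Continuous.intervalIntegrable (by fun_prop) _ _)
    (Continuous.intervalIntegrable (by fun_prop) _ _) fun v hv => ?_
  have := (le_abs_self _).trans (hb v hv)
  linarith

/-- Integration by parts: a slowly oscillating weight averages a function with small means. -/
theorem abs_integral_mul_le_of_small_mean {W W' r : ℝ → ℝ} {A B C η K : ℝ} (hA : 0 < A)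
    (hAB : A ≤ B) (hη : 0 < η) (hK : K ≤ η * A)
    (hW : ∀ v, HasDerivAt W (W' v) v) (hW' : Continuous W') (hpos : ∀ v, 0 < W v)
    (hb : ∀ v ∈ Icc 0 B, |v * W' v| ≤ C * W v) (hr : Continuous r)
    (hrK : ∀ u v, u ≤ v → |∫ w in u..v, r w| ≤ η * (v - u) + K) :
    |∫ v in A..B, W v * r v| ≤ η * (1 + 2 * C) * ∫ v in (0:ℝ)..B, W v := by
  have hWc : Continuous W := continuous_iff_continuousAt.2 fun v => (hW v).continuousAt
  set R : ℝ → ℝ := fun v => ∫ w in A..v, r w with hR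
  have hRd : ∀ v, HasDerivAt R (r v) v := fun v =>
    (hr.integral_hasStrictDerivAt A v).hasDerivAt
  have hRc : Continuous R := continuous_iff_continuousAt.2 fun v => (hRd v).continuousAt
  have hRb : ∀ v, A ≤ v → |R v| ≤ η * v := fun v hv => by
    have := hrK A v hv
    have e : η * (v - A) + K ≤ η * v := by nlinarith
    exact this.trans e
  have hibp := intervalIntegral.integral_mul_deriv_eq_deriv_mul (a := A) (b := B)
    (fun v _ => hW v) (fun v _ => hRd v) (hW'.intervalIntegrable _ _) (hr.intervalIntegrable _ _)
  have hRA : R A = 0 := by simp [hR]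
  rw [hibp, hRA, mul_zero, sub_zero]
  have hB : 0 ≤ B := hA.le.trans hAB
  have hC : 0 ≤ C := by
    have h1 := (abs_nonneg _).trans (hb 0 ⟨le_rfl, hB⟩)
    exact nonneg_of_mul_nonneg_left h1 (hpos 0)
  have h0 := mul_le_integral_of_abs_mul_deriv_le hB hW hW' hb
  have h1 : |W B * R B| ≤ η * (1 + C) * ∫ v in (0:ℝ)..B, W v := by
    rw [abs_mul, abs_of_pos (hpos B)]
    have := mul_le_mul_of_nonneg_left (hRb B hAB) (hpos B).le
    nlinarith
  have h2 : |∫ v in A..B, W' v * R v| ≤ η * C * ∫ v in (0:ℝ)..B, W v := by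
    have h3 : |∫ v in A..B, W' v * R v| ≤ ∫ v in A..B, η * C * W v := by
      rw [← Real.norm_eq_abs]
      refine intervalIntegral.norm_integral_le_of_norm_le hAB (Eventually.of_forall fun v hv => ?_)
        (Continuous.intervalIntegrable (by fun_prop) _ _)
      have hv0 : 0 < v := hA.trans hv.1
      rw [Real.norm_eq_abs, abs_mul]
      calc |W' v| * |R v| ≤ |W' v| * (η * v) :=
            mul_le_mul_of_nonneg_left (hRb v hv.1.le) (abs_nonneg _)
        _ = η * |v * W' v| := by rw [abs_mul, abs_of_pos hv0]; ring
        _ ≤ η * (C * W v) := mul_le_mul_of_nonneg_left (hb v ⟨hv0.le, hv.2⟩) hη.le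
        _ = η * C * W v := by ring
    refine h3.trans ?_
    rw [intervalIntegral.integral_const_mul]
    refine mul_le_mul_of_nonneg_left ?_ (by positivity)
    exact intervalIntegral.integral_mono_interval hA.le hAB le_rfl
      (Eventually.of_forall fun v => (hpos v).le) (hWc.intervalIntegrable _ _)
  have := abs_sub (W B * R B) (∫ v in A..B, W' v * R v)
  calc _ ≤ _ := this
    _ ≤ _ := add_le_add h1 h2
    _ = _ := by ring

/-- Positive `C¹` functions with `|x f'(x)| ≤ C f(x)` for `x ≥ 0` and divergent integral: these are
the functions `f(x) = φ(eˣ)` for the slowly varying functions `φ` under consideration. -/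
structure LogSmooth (f : ℝ → ℝ) (C : ℝ) : Prop where
  pos : ∀ x, 0 < f x
  contDiff : ContDiff ℝ 1 f
  bound : ∀ x, 0 ≤ x → |x * deriv f x| ≤ C * f x
  div : Tendsto (fun B => ∫ v in (0:ℝ)..B, f v) atTop atTop

namespace LogSmooth

variable {f g : ℝ → ℝ} {C : ℝ}

theorem const_nonneg (hf : LogSmooth f C) : 0 ≤ C :=
  nonneg_of_mul_nonneg_left ((abs_nonneg _).trans (hf.bound 0 le_rfl)) (hf.pos 0)

theorem continuous (hf : LogSmooth f C) : Continuous f := hf.contDiff.continuous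

theorem hasDerivAt (hf : LogSmooth f C) (x : ℝ) : HasDerivAt f (deriv f x) x :=
  (hf.contDiff.differentiable one_ne_zero x).hasDerivAt

theorem continuous_deriv (hf : LogSmooth f C) : Continuous (deriv f) :=
  hf.contDiff.continuous_deriv le_rfl

theorem eventually_le_two_mul (hf : LogSmooth f C) {A : ℝ} (hA : 0 ≤ A) :
    ∀ᶠ x in atTop, ∀ u, |u| ≤ A → f (x - u) ≤ 2 * f x ∧ f x ≤ 2 * f (x - u) := by
  have hC := hf.const_nonneg
  have hlog2 : 0 < Real.log 2 := Real.log_pos one_lt_two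
  filter_upwards [eventually_gt_atTop (A + C * A / Real.log 2), eventually_gt_atTop A]
    with x hx hxA u hu
  have hxA' : 0 < x - A := sub_pos.2 hxA
  have hder : ∀ y ∈ Ici (x - A), HasDerivWithinAt (fun y => Real.log (f y))
      (deriv f y / f y) (Ici (x - A)) y := fun y _ =>
    ((hf.hasDerivAt y).log (hf.pos y).ne').hasDerivWithinAt
  have hbd : ∀ y ∈ Ici (x - A), ‖deriv f y / f y‖ ≤ C / (x - A) := fun y hy => by
    have hy' : x - A ≤ y := hy
    have hy0 : 0 < y := hxA'.trans_le hy'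
    have h1 := hf.bound y hy0.le
    rw [abs_mul, abs_of_pos hy0] at h1
    rw [norm_div, Real.norm_eq_abs, Real.norm_eq_abs, abs_of_pos (hf.pos y),
      div_le_div_iff₀ (hf.pos y) hxA']
    nlinarith [abs_nonneg (deriv f y)]
  have habs := abs_le.1 hu
  have h1 := (convex_Ici (x - A)).norm_image_sub_le_of_norm_hasDerivWithin_le hder hbd
    (x := x) (y := x - u) (mem_Ici.2 (by linarith)) (mem_Ici.2 (by linarith))
  have h2 : C / (x - A) * ‖x - u - x‖ ≤ Real.log 2 := by
    have e : ‖x - u - x‖ = |u| := by rw [sub_sub_cancel_left, norm_neg, Real.norm_eq_abs]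
    rw [e, div_mul_eq_mul_div, div_le_iff₀ hxA']
    have h3 : C * A / Real.log 2 < x - A := by linarith
    rw [div_lt_iff₀ hlog2] at h3
    nlinarith
  have h3 := abs_le.1 (h1.trans h2)
  constructor
  · rw [← Real.log_le_log_iff (hf.pos _) (mul_pos two_pos (hf.pos _)),
      Real.log_mul two_ne_zero (hf.pos _).ne']
    linarith [h3.2]
  · rw [← Real.log_le_log_iff (hf.pos _) (mul_pos two_pos (hf.pos _)),
      Real.log_mul two_ne_zero (hf.pos _).ne']
    linarith [h3.1]

theorem eventually_le_integral (hf : LogSmooth f C) (hg : LogSmooth g C) {η : ℝ} (hη : 0 < η) :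
    ∀ᶠ x in atTop, g x ≤ η * ∫ v in (0:ℝ)..(x / 2), f v * g (x - v) := by
  obtain ⟨B, hB, hB0⟩ := ((hf.div.eventually_ge_atTop (2 / η)).and (eventually_ge_atTop 0)).exists
  filter_upwards [hg.eventually_le_two_mul hB0, eventually_ge_atTop (2 * B)] with x hx hxB
  have hfc := hf.continuous
  have hgc := hg.continuous
  have h1 : ∫ v in (0:ℝ)..B, f v * (g x / 2) ≤ ∫ v in (0:ℝ)..B, f v * g (x - v) := by
    refine intervalIntegral.integral_mono_on hB0 (Continuous.intervalIntegrable (by fun_prop) _ _)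
      (Continuous.intervalIntegrable (by fun_prop) _ _) fun v hv => ?_
    refine mul_le_mul_of_nonneg_left ?_ (hf.pos v).le
    have := (hx v (by rw [abs_of_nonneg hv.1]; exact hv.2)).2
    linarith
  have h2 : ∫ v in (0:ℝ)..B, f v * g (x - v) ≤ ∫ v in (0:ℝ)..(x / 2), f v * g (x - v) :=
    intervalIntegral.integral_mono_interval le_rfl hB0 (by linarith)
      (Eventually.of_forall fun v => (mul_pos (hf.pos v) (hg.pos _)).le)
      (Continuous.intervalIntegrable (by fun_prop) _ _)
  rw [intervalIntegral.integral_mul_const] at h1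
  have h3 : g x / η ≤ ∫ v in (0:ℝ)..(x / 2), f v * g (x - v) := by
    refine le_trans ?_ (h1.trans h2)
    have := mul_le_mul_of_nonneg_right hB (half_pos (hg.pos x)).le
    calc g x / η = 2 / η * (g x / 2) := by ring
      _ ≤ _ := this
  rw [div_le_iff₀ hη] at h3
  linarith

theorem hasDerivAt_mul_reflect (hf : LogSmooth f C) (hg : LogSmooth g C) (x v : ℝ) :
    HasDerivAt (fun v => f v * g (x - v)) (deriv f v * g (x - v) - f v * deriv g (x - v)) v := by
  have h1 : HasDerivAt (fun v => g (x - v)) (-deriv g (x - v)) v :=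
    (hg.hasDerivAt (x - v)).comp_const_sub x v
  exact ((hf.hasDerivAt v).mul h1).congr_deriv (by ring)

theorem abs_mul_deriv_reflect_le (hf : LogSmooth f C) (hg : LogSmooth g C) {x v : ℝ}
    (hv : v ∈ Icc 0 (x / 2)) :
    |v * (deriv f v * g (x - v) - f v * deriv g (x - v))| ≤ 2 * C * (f v * g (x - v)) := by
  have hv0 := hv.1
  have hv2 : v ≤ x - v := by linarith [hv.2]
  have h1 := hf.bound v hv0
  have h2 := hg.bound (x - v) (hv0.trans hv2)
  have h3 : |v * deriv g (x - v)| ≤ C * g (x - v) := by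
    refine le_trans ?_ h2
    rw [abs_mul, abs_mul]
    refine mul_le_mul_of_nonneg_right ?_ (abs_nonneg _)
    rw [abs_of_nonneg hv0, abs_of_nonneg (hv0.trans hv2)]
    exact hv2
  have e : v * (deriv f v * g (x - v) - f v * deriv g (x - v))
      = (v * deriv f v) * g (x - v) - f v * (v * deriv g (x - v)) := by ring
  rw [e]
  refine (abs_sub _ _).trans ?_
  rw [abs_mul _ (g (x - v)), abs_mul (f v), abs_of_pos (hf.pos v), abs_of_pos (hg.pos (x - v))]
  have h4 := mul_le_mul_of_nonneg_right h1 (hg.pos (x - v)).le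
  have h5 := mul_le_mul_of_nonneg_left h3 (hf.pos v).le
  linarith

end LogSmooth

/-- `α(v) ~ f(v) s(v)` as `v → ∞`, with `α` measurable and bounded on half-lines `(-∞, A]`. -/
structure ModulatedBy (α f s : ℝ → ℝ) : Prop where
  measurable : Measurable α
  locally_bounded : ∀ A, ∃ K, ∀ v ≤ A, |α v| ≤ K
  asymp : ∀ ε > 0, ∀ᶠ v in atTop, |α v - f v * s v| ≤ ε * f v

theorem ModulatedBy.intervalIntegrable_mul_reflect {α β f g s st : ℝ → ℝ}
    (hα : ModulatedBy α f s) (hβ : ModulatedBy β g st) (x a b : ℝ) :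
    IntervalIntegrable (fun v => α v * β (x - v)) volume a b := by
  obtain ⟨K₁, hK₁⟩ := hα.locally_bounded (max a b)
  obtain ⟨K₂, hK₂⟩ := hβ.locally_bounded (x - min a b)
  have hm : Measurable (fun v => α v * β (x - v)) :=
    hα.measurable.mul (hβ.measurable.comp (measurable_const.sub measurable_id))
  rw [intervalIntegrable_iff]
  refine Measure.integrableOn_of_bounded (M := K₁ * K₂) ?_ hm.aestronglyMeasurable ?_
  · rw [uIoc]; exact measure_Ioc_lt_top.ne
  · refine (ae_restrict_mem measurableSet_uIoc).mono fun v hv => ?_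
    rw [uIoc] at hv
    rw [norm_mul]
    have h1 := hK₁ v hv.2
    have h2 := hK₂ (x - v) (by linarith [hv.1])
    exact mul_le_mul h1 h2 (abs_nonneg _) ((abs_nonneg _).trans h1)

/-- Asymptotics of the part `v ≤ x / 2` of the convolution of `α ~ f s` and `β ~ g s̃`. -/
theorem ModulatedBy.eventually_abs_integral_half_sub_le {α β f g s st : ℝ → ℝ} {C m D : ℝ}
    (hf : LogSmooth f C) (hg : LogSmooth g C)
    (hα : ModulatedBy α f s) (hβ : ModulatedBy β g st)
    (hs : Continuous s) (hst : Continuous st)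
    (hsb : ∃ M, ∀ x, |s x| ≤ M) (hstb : ∃ M, ∀ x, |st x| ≤ M)
    (hmean : ∀ ε > 0, ∃ K, ∀ x u v : ℝ, u ≤ v →
      |∫ w in u..v, (s w * st (x - w) - m)| ≤ ε * (v - u) + K)
    (hD : 0 ≤ D) {ε : ℝ} (hε : 0 < ε) :
    ∀ᶠ x in atTop, |(∫ v in (-D)..(x / 2), α v * β (x - v))
      - m * ∫ v in (0:ℝ)..(x / 2), f v * g (x - v)|
        ≤ ε * ∫ v in (0:ℝ)..(x / 2), f v * g (x - v) := by
  obtain ⟨M₁, hM₁⟩ := hsb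
  obtain ⟨M₂, hM₂⟩ := hstb
  set M := max M₁ M₂
  have hsM : ∀ x, |s x| ≤ M := fun x => (hM₁ x).trans (le_max_left _ _)
  have hstM : ∀ x, |st x| ≤ M := fun x => (hM₂ x).trans (le_max_right _ _)
  have hM0 : 0 ≤ M := (abs_nonneg _).trans (hsM 0)
  have hC := hf.const_nonneg
  have hfc := hf.continuous
  have hgc := hg.continuous
  set c := 4 * ((2 * M + 1) + (1 + 2 * (2 * C))) with hc
  have hcpos : 0 < c := by positivity
  set η := min 1 (ε / c) with hη
  have hηpos : 0 < η := lt_min one_pos (div_pos hε hcpos)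
  have hη1 : η ≤ 1 := min_le_left _ _
  have hηc : η * c ≤ ε := by
    have : η ≤ ε / c := min_le_right _ _
    rwa [le_div_iff₀ hcpos] at this
  obtain ⟨K, hK⟩ := hmean η hηpos
  obtain ⟨A₁, hA₁⟩ := eventually_atTop.1 (hα.asymp η hηpos)
  obtain ⟨A₂, hA₂⟩ := eventually_atTop.1 (hβ.asymp η hηpos)
  obtain ⟨A, hAmax, hA1⟩ : ∃ A, max (max A₁ A₂) (K / η) ≤ A ∧ 1 ≤ A :=
    ⟨max (max (max A₁ A₂) (K / η)) 1, le_max_left _ _, le_max_right _ _⟩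
  have hAA₁ : A₁ ≤ A := ((le_max_left _ _).trans (le_max_left _ _)).trans hAmax
  have hAA₂ : A₂ ≤ A := ((le_max_right _ _).trans (le_max_left _ _)).trans hAmax
  have hKA : K ≤ η * A := by
    have := (le_max_right _ _).trans hAmax
    rw [div_le_iff₀ hηpos] at this
    linarith
  have hA0 : 0 < A := one_pos.trans_le hA1
  obtain ⟨Kα, hKα⟩ := hα.locally_bounded A
  have hKα0 : 0 ≤ Kα := (abs_nonneg _).trans (hKα A le_rfl)
  have hβb : ∀ v, A ≤ v → |β v| ≤ (M + 1) * g v := fun v hv => by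
    have h1 := hA₂ v (hAA₂.trans hv)
    have h2 : |g v * st v| ≤ g v * M := by
      rw [abs_mul, abs_of_pos (hg.pos v)]
      exact mul_le_mul_of_nonneg_left (hstM v) (hg.pos v).le
    have h3 := abs_add_le (β v - g v * st v) (g v * st v)
    rw [sub_add_cancel] at h3
    nlinarith [hg.pos v]
  set c₁ := Kα * ((M + 1) * 2) * (A + D) with hc₁
  set c₂ := |m| * (2 * ∫ v in (0:ℝ)..A, f v) with hc₂
  have hintf : 0 ≤ ∫ v in (0:ℝ)..A, f v :=
    intervalIntegral.integral_nonneg hA0.le fun v _ => (hf.pos v).le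
  have hc₁0 : 0 ≤ c₁ := by positivity
  have hc₂0 : 0 ≤ c₂ := by positivity
  have hη' : 0 < ε / (2 * (c₁ + c₂ + 1)) := by positivity
  filter_upwards [hg.eventually_le_two_mul (A := A + D) (by positivity),
    hf.eventually_le_integral hg hη', eventually_ge_atTop (2 * A)] with x hx2 hgK hxA
  set K₁ := ∫ v in (0:ℝ)..(x / 2), f v * g (x - v) with hK₁
  have hWpos : ∀ v, 0 < f v * g (x - v) := fun v => mul_pos (hf.pos v) (hg.pos _)
  have hWc : Continuous (fun v => f v * g (x - v)) := by fun_prop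
  have hK₁0 : 0 ≤ K₁ := intervalIntegral.integral_nonneg (by linarith) fun v _ => (hWpos v).le
  have hAx : A ≤ x / 2 := by linarith
  have hαβ := hα.intervalIntegrable_mul_reflect hβ x
  have hsub : ∫ v in A..(x / 2), f v * g (x - v) ≤ K₁ :=
    intervalIntegral.integral_mono_interval hA0.le hAx le_rfl
      (Eventually.of_forall fun v => (hWpos v).le) (hWc.intervalIntegrable _ _)
  -- the initial segment
  have hseg : |∫ v in (-D)..A, α v * β (x - v)| ≤ c₁ * g x := by
    have h1 := intervalIntegral.norm_integral_le_of_norm_le_const (a := -D) (b := A)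
      (f := fun v => α v * β (x - v)) (C := Kα * ((M + 1) * (2 * g x))) fun v hv => by
        rw [uIoc_of_le (by linarith)] at hv
        rw [norm_mul]
        refine mul_le_mul (hKα v hv.2) ?_ (norm_nonneg _) hKα0
        have hvb : |v| ≤ A + D := abs_le.2 ⟨by linarith [hv.1], by linarith [hv.2]⟩
        refine (hβb (x - v) (by linarith [hv.2])).trans ?_
        exact mul_le_mul_of_nonneg_left (hx2 v hvb).1 (by positivity)
    rw [Real.norm_eq_abs, sub_neg_eq_add, abs_of_nonneg (add_nonneg hA0.le hD)] at h1
    calc _ ≤ _ := h1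
      _ = _ := by rw [hc₁]; ring
  have hseg' : |m * ∫ v in (0:ℝ)..A, f v * g (x - v)| ≤ c₂ * g x := by
    have h1 : ∫ v in (0:ℝ)..A, f v * g (x - v) ≤ ∫ v in (0:ℝ)..A, f v * (2 * g x) := by
      refine intervalIntegral.integral_mono_on hA0.le (hWc.intervalIntegrable _ _)
        (Continuous.intervalIntegrable (by fun_prop) _ _) fun v hv => ?_
      refine mul_le_mul_of_nonneg_left (hx2 v ?_).1 (hf.pos v).le
      rw [abs_of_nonneg hv.1]; linarith [hv.2]
    rw [intervalIntegral.integral_mul_const] at h1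
    rw [abs_mul, abs_of_nonneg (intervalIntegral.integral_nonneg hA0.le fun v _ => (hWpos v).le)]
    calc _ ≤ |m| * ((∫ v in (0:ℝ)..A, f v) * (2 * g x)) :=
          mul_le_mul_of_nonneg_left h1 (abs_nonneg _)
      _ = c₂ * g x := by rw [hc₂]; ring
  -- replacing `α` and `β` by their asymptotics
  have hrep : |∫ v in A..(x / 2), (α v * β (x - v) - f v * g (x - v) * (s v * st (x - v)))|
      ≤ η * (2 * M + 1) * K₁ := by
    have h1 : |∫ v in A..(x / 2), (α v * β (x - v) - f v * g (x - v) * (s v * st (x - v)))|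
        ≤ ∫ v in A..(x / 2), η * (2 * M + 1) * (f v * g (x - v)) := by
      rw [← Real.norm_eq_abs]
      refine intervalIntegral.norm_integral_le_of_norm_le hAx (Eventually.of_forall fun v hv => ?_)
        (Continuous.intervalIntegrable (by fun_prop) _ _)
      have hvx : A ≤ x - v := by linarith [hv.2]
      have e1 := hA₁ v (hAA₁.trans hv.1.le)
      have e2 := hA₂ (x - v) (hAA₂.trans hvx)
      have e3 := hβb (x - v) hvx
      have e : α v * β (x - v) - f v * g (x - v) * (s v * st (x - v))
          = (α v - f v * s v) * β (x - v)
            + f v * s v * (β (x - v) - g (x - v) * st (x - v)) := by ring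
      rw [Real.norm_eq_abs, e]
      refine (abs_add_le _ _).trans ?_
      rw [abs_mul, abs_mul, abs_mul (f v), abs_of_pos (hf.pos v)]
      have hfv := hf.pos v
      have hgv := hg.pos (x - v)
      have h2 : |α v - f v * s v| * |β (x - v)| ≤ (η * f v) * ((M + 1) * g (x - v)) :=
        mul_le_mul e1 e3 (abs_nonneg _) (by positivity)
      have h3 : f v * |s v| * |β (x - v) - g (x - v) * st (x - v)|
          ≤ (f v * M) * (η * g (x - v)) :=
        mul_le_mul (mul_le_mul_of_nonneg_left (hsM v) hfv.le) e2 (abs_nonneg _) (by positivity)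
      calc _ ≤ _ := add_le_add h2 h3
        _ = _ := by ring
    rw [intervalIntegral.integral_const_mul] at h1
    exact h1.trans (mul_le_mul_of_nonneg_left hsub (by positivity))
  have hosc : |∫ v in A..(x / 2), f v * g (x - v) * (s v * st (x - v) - m)|
      ≤ η * (1 + 2 * (2 * C)) * K₁ := by
    refine abs_integral_mul_le_of_small_mean hA0 hAx hηpos hKA
      (hf.hasDerivAt_mul_reflect hg x) ?_ hWpos
      (fun v hv => hf.abs_mul_deriv_reflect_le hg hv) (by fun_prop) (hK x)
    have := hf.continuous_deriv
    have := hg.continuous_deriv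
    fun_prop
  have hsplit : (∫ v in (-D)..(x / 2), α v * β (x - v)) - m * K₁
      = (∫ v in (-D)..A, α v * β (x - v)) - m * (∫ v in (0:ℝ)..A, f v * g (x - v))
        + (∫ v in A..(x / 2), (α v * β (x - v) - f v * g (x - v) * (s v * st (x - v))))
        + ∫ v in A..(x / 2), f v * g (x - v) * (s v * st (x - v) - m) := by
    have e1 := intervalIntegral.integral_add_adjacent_intervals (hαβ (-D) A) (hαβ A (x / 2))
    have e2 := intervalIntegral.integral_add_adjacent_intervals (μ := volume)
      (hWc.intervalIntegrable 0 A) (hWc.intervalIntegrable A (x / 2))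
    have e3 : (∫ v in A..(x / 2), (α v * β (x - v) - f v * g (x - v) * (s v * st (x - v))))
        + (∫ v in A..(x / 2), f v * g (x - v) * (s v * st (x - v) - m))
        + m * (∫ v in A..(x / 2), f v * g (x - v))
        = ∫ v in A..(x / 2), α v * β (x - v) := by
      have i2 : IntervalIntegrable (fun v => f v * g (x - v) * (s v * st (x - v) - m)) volume
        A (x / 2) := Continuous.intervalIntegrable (by fun_prop) _ _
      have i3 : IntervalIntegrable (fun v => m * (f v * g (x - v))) volume
        A (x / 2) := Continuous.intervalIntegrable (by fun_prop) _ _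
      have i1 : IntervalIntegrable
          (fun v => α v * β (x - v) - f v * g (x - v) * (s v * st (x - v))) volume A (x / 2) :=
        (hαβ _ _).sub (Continuous.intervalIntegrable (by fun_prop) _ _)
      rw [← intervalIntegral.integral_const_mul, ← intervalIntegral.integral_add i1 i2,
        ← intervalIntegral.integral_add (i1.add i2) i3]
      congr 1; ext v; ring
    rw [hK₁, ← e1, ← e2]
    linear_combination -e3
  rw [hsplit]
  have hgb : (c₁ + c₂) * g x ≤ ε / 2 * K₁ := by
    have h1 := mul_le_mul_of_nonneg_left hgK (add_nonneg hc₁0 hc₂0)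
    refine h1.trans ?_
    have h2 : (c₁ + c₂) * (ε / (2 * (c₁ + c₂ + 1))) ≤ ε / 2 := by
      rw [← mul_div_assoc, div_le_div_iff₀ (by positivity) two_pos]
      nlinarith
    calc _ = (c₁ + c₂) * (ε / (2 * (c₁ + c₂ + 1))) * K₁ := by ring
      _ ≤ _ := mul_le_mul_of_nonneg_right h2 hK₁0
  have hηb : η * ((2 * M + 1) + (1 + 2 * (2 * C))) * K₁ ≤ ε / 4 * K₁ := by
    refine mul_le_mul_of_nonneg_right ?_ hK₁0
    rw [hc] at hηc
    linarith
  have t1 := abs_add_le ((∫ v in (-D)..A, α v * β (x - v))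
    - m * (∫ v in (0:ℝ)..A, f v * g (x - v))
    + (∫ v in A..(x / 2), (α v * β (x - v) - f v * g (x - v) * (s v * st (x - v)))))
    (∫ v in A..(x / 2), f v * g (x - v) * (s v * st (x - v) - m))
  have t2 := abs_add_le ((∫ v in (-D)..A, α v * β (x - v))
    - m * (∫ v in (0:ℝ)..A, f v * g (x - v)))
    (∫ v in A..(x / 2), (α v * β (x - v) - f v * g (x - v) * (s v * st (x - v))))
  have t3 := abs_sub (∫ v in (-D)..A, α v * β (x - v))
    (m * (∫ v in (0:ℝ)..A, f v * g (x - v)))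
  nlinarith

/-- The convolution of `α ~ f s` and `β ~ g s̃` is asymptotic to the joint mean `m` of `s` and `s̃`
times the convolution of `f` and `g`. -/
theorem ModulatedBy.tendsto_conv_div {α β f g s st : ℝ → ℝ} {C m D : ℝ}
    (hf : LogSmooth f C) (hg : LogSmooth g C)
    (hα : ModulatedBy α f s) (hβ : ModulatedBy β g st)
    (hs : Continuous s) (hst : Continuous st)
    (hsb : ∃ M, ∀ x, |s x| ≤ M) (hstb : ∃ M, ∀ x, |st x| ≤ M)
    (hmean : ∀ ε > 0, ∃ K, ∀ x u v : ℝ, u ≤ v →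
      |∫ w in u..v, (s w * st (x - w) - m)| ≤ ε * (v - u) + K)
    (hmean' : ∀ ε > 0, ∃ K, ∀ x u v : ℝ, u ≤ v →
      |∫ w in u..v, (st w * s (x - w) - m)| ≤ ε * (v - u) + K)
    (hD : 0 ≤ D) :
    Tendsto (fun x => (∫ v in (-D)..(x + D), α v * β (x - v))
      / ∫ v in (0:ℝ)..x, f v * g (x - v)) atTop (nhds m) := by
  rw [Metric.tendsto_nhds]
  intro ε hε
  filter_upwards [hα.eventually_abs_integral_half_sub_le hf hg hβ hs hst hsb hstb hmean hD
      (half_pos hε),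
    hβ.eventually_abs_integral_half_sub_le hg hf hα hst hs hstb hsb hmean' hD (half_pos hε),
    eventually_gt_atTop 0] with x h1 h2 hx
  have hfc := hf.continuous
  have hgc := hg.continuous
  have hWc : Continuous (fun v => f v * g (x - v)) := by fun_prop
  have e1 := intervalIntegral.integral_add_adjacent_intervals
    (hα.intervalIntegrable_mul_reflect hβ x (-D) (x / 2))
    (hα.intervalIntegrable_mul_reflect hβ x (x / 2) (x + D))
  have e2 := intervalIntegral.integral_add_adjacent_intervals (μ := volume)
    (hWc.intervalIntegrable 0 (x / 2)) (hWc.intervalIntegrable (x / 2) x)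
  have e3 : ∫ v in (x / 2)..(x + D), α v * β (x - v)
      = ∫ v in (-D)..(x / 2), β v * α (x - v) := by
    have := intervalIntegral.integral_comp_sub_left (a := x / 2) (b := x + D)
      (fun v => β v * α (x - v)) x
    simp only [sub_sub_cancel] at this
    rw [show x - (x + D) = -D by ring, show x - x / 2 = x / 2 by ring] at this
    rw [← this]
    congr 1; ext v; ring
  have e4 : ∫ v in (x / 2)..x, f v * g (x - v)
      = ∫ v in (0:ℝ)..(x / 2), g v * f (x - v) := by
    have := intervalIntegral.integral_comp_sub_left (a := x / 2) (b := x)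
      (fun v => g v * f (x - v)) x
    simp only [sub_sub_cancel, sub_self] at this
    rw [show x - x / 2 = x / 2 by ring] at this
    rw [← this]
    congr 1; ext v; ring
  have hpos : 0 < ∫ v in (0:ℝ)..x, f v * g (x - v) :=
    intervalIntegral.intervalIntegral_pos_of_pos (hWc.intervalIntegrable _ _)
      (fun v => mul_pos (hf.pos v) (hg.pos _)) hx
  rw [Real.dist_eq]
  have e5 : (∫ v in (-D)..(x + D), α v * β (x - v)) / (∫ v in (0:ℝ)..x, f v * g (x - v)) - m
      = ((∫ v in (-D)..(x + D), α v * β (x - v)) - m * ∫ v in (0:ℝ)..x, f v * g (x - v))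
        / ∫ v in (0:ℝ)..x, f v * g (x - v) := by
    field_simp
  rw [e5, abs_div, abs_of_pos hpos, div_lt_iff₀ hpos]
  have e6 : (∫ v in (-D)..(x + D), α v * β (x - v)) - m * ∫ v in (0:ℝ)..x, f v * g (x - v)
      = ((∫ v in (-D)..(x / 2), α v * β (x - v)) - m * ∫ v in (0:ℝ)..(x / 2), f v * g (x - v))
      + ((∫ v in (-D)..(x / 2), β v * α (x - v))
        - m * ∫ v in (0:ℝ)..(x / 2), g v * f (x - v)) := by
    rw [← e1, ← e2, e3, e4]; ring
  rw [e6]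
  refine (abs_add_le _ _).trans_lt ?_
  have e7 := e2
  rw [e4] at e7
  nlinarith

/-- Monotone density theorem for functions growing exponentially up to slow variation. -/
theorem tendsto_div_of_primitive_tendsto_div {F J Q : ℝ → ℝ} {m p : ℝ}
    (hQ : ∀ᶠ x in atTop, 0 < Q x)
    (hJF : ∀ x y, 0 ≤ x → x ≤ y → (y - x) * F x ≤ J y - J x ∧ J y - J x ≤ (y - x) * F y)
    (hJ : Tendsto (fun x => J x / Q x) atTop (nhds m))
    (hQd : ∀ δ, Tendsto (fun x => Q (x + δ) / Q x) atTop (nhds (exp (δ / p)))) :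
    Tendsto (fun x => F x / Q x) atTop (nhds (m / p)) := by
  have hslope : ∀ δ, Tendsto (fun x => (J (x + δ) - J x) / δ / Q x) atTop
      (nhds (m * ((exp (δ / p) - 1) / δ))) := by
    intro δ
    have hshift : Tendsto (fun x : ℝ => x + δ) atTop atTop := tendsto_atTop_add_const_right _ _ tendsto_id
    have h1 : Tendsto (fun x => J (x + δ) / Q (x + δ) * (Q (x + δ) / Q x)) atTop
        (nhds (m * exp (δ / p))) := (hJ.comp hshift).mul (hQd δ)
    have h2 := (h1.sub hJ).div_const δ
    have e : (m * exp (δ / p) - m) / δ = m * ((exp (δ / p) - 1) / δ) := by ring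
    rw [e] at h2
    refine h2.congr' ?_
    filter_upwards [hQ, hshift.eventually hQ] with x hx hx'
    field_simp
  have hexp : Tendsto (fun δ => m * ((exp (δ / p) - 1) / δ)) (nhdsWithin 0 {0}ᶜ) (nhds (m / p)) := by
    have hd : HasDerivAt (fun δ => exp (δ / p)) (exp (0 / p) * (1 / p)) 0 :=
      ((hasDerivAt_id (0:ℝ)).div_const p).exp
    have h1 := (hasDerivAt_iff_tendsto_slope.1 hd).const_mul m
    rw [zero_div, exp_zero, one_mul, mul_one_div] at h1
    refine h1.congr fun δ => ?_
    rw [slope_def_field]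
    simp
  rw [tendsto_order]
  constructor
  · intro a ha
    have h1 : ∀ᶠ δ in nhdsWithin (0:ℝ) (Iio 0), a < m * ((exp (δ / p) - 1) / δ) :=
      (hexp.mono_left (nhdsWithin_mono _ fun x hx => ne_of_lt hx)).eventually_const_lt ha
    obtain ⟨δ, hδa, hδ⟩ := (h1.and self_mem_nhdsWithin).exists
    have hδ0 : δ < 0 := hδ
    filter_upwards [(hslope δ).eventually_const_lt hδa, hQ, eventually_ge_atTop (-δ)]
      with x hx hQx hxδ
    refine hx.trans_le (div_le_div_of_nonneg_right ?_ hQx.le)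
    have := (hJF (x + δ) x (by linarith) (by linarith)).2
    rw [div_le_iff_of_neg hδ0]
    linarith
  · intro a ha
    have h1 : ∀ᶠ δ in nhdsWithin (0:ℝ) (Ioi 0), m * ((exp (δ / p) - 1) / δ) < a :=
      (hexp.mono_left (nhdsWithin_mono _ fun x hx => ne_of_gt hx)).eventually_lt_const ha
    obtain ⟨δ, hδa, hδ⟩ := (h1.and self_mem_nhdsWithin).exists
    have hδ0 : 0 < δ := hδ
    filter_upwards [(hslope δ).eventually_lt_const hδa, hQ, eventually_ge_atTop 0]
      with x hx hQx hx0
    refine (div_le_div_of_nonneg_right ?_ hQx.le).trans_lt hx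
    have := (hJF x (x + δ) hx0 (by linarith)).1
    rw [le_div_iff₀ hδ0]
    linarith

theorem cntF_exp_neg_eq_sum {lam : ℕ → ℝ} (hpos : ∀ n, 0 < lam n)
    (hlim : Tendsto lam atTop (nhds 0)) (V : ℝ) :
    ∀ᶠ n in atTop, ∀ v ≤ V, cntF lam (exp (-v))
      = ∑ k ∈ Finset.range n, if -log (lam k) < v then (1:ℝ) else 0 := by
  obtain ⟨n₀, hn₀⟩ := eventually_atTop.1 (hlim.eventually_lt_const (exp_pos (-V)))
  filter_upwards [eventually_ge_atTop n₀] with n hn v hv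
  have hiff : ∀ k, exp (-v) < lam k ↔ -log (lam k) < v := fun k => by
    rw [← Real.lt_log_iff_exp_lt (hpos k)]
    constructor <;> intro h <;> linarith
  have hset : {k : ℕ | exp (-v) < lam k}
      = ((Finset.range n).filter fun k => -log (lam k) < v : Finset ℕ) := by
    ext k
    simp only [mem_ofPred_eq, Finset.coe_filter, Finset.mem_range, hiff]
    refine ⟨fun h => ⟨?_, h⟩, fun h => h.2⟩
    by_contra hk
    have h1 := hn₀ k (hn.trans (not_lt.1 hk))
    have h2 := (hiff k).2 h
    have h3 : exp (-V) ≤ exp (-v) := exp_le_exp.2 (by linarith)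
    linarith
  unfold cntF
  rw [hset, Nat.card_coe_set_eq, Set.ncard_coe_finset, Finset.card_filter]
  push_cast
  rfl

theorem cntTensor_exp_neg_eq_sum {lam lamt : ℕ → ℝ} (hpos : ∀ n, 0 < lam n)
    (hpost : ∀ n, 0 < lamt n) (hlim : Tendsto lam atTop (nhds 0))
    (hlimt : Tendsto lamt atTop (nhds 0)) {D : ℝ} (hD : ∀ n, -D ≤ -log (lam n))
    (hDt : ∀ n, -D ≤ -log (lamt n)) (V : ℝ) :
    ∀ᶠ n in atTop, ∀ v ≤ V, cntTensor lam lamt (exp (-v))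
      = ∑ q ∈ Finset.range n ×ˢ Finset.range n,
        if -log (lam q.1) + -log (lamt q.2) < v then (1:ℝ) else 0 := by
  obtain ⟨n₁, hn₁⟩ := eventually_atTop.1 (hlim.eventually_lt_const (exp_pos (-(V + D))))
  obtain ⟨n₂, hn₂⟩ := eventually_atTop.1 (hlimt.eventually_lt_const (exp_pos (-(V + D))))
  filter_upwards [eventually_ge_atTop n₁, eventually_ge_atTop n₂] with n hn hn' v hv
  have hiff : ∀ q : ℕ × ℕ, exp (-v) < lam q.1 * lamt q.2
      ↔ -log (lam q.1) + -log (lamt q.2) < v := fun q => by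
    rw [← Real.lt_log_iff_exp_lt (mul_pos (hpos _) (hpost _)),
      Real.log_mul (hpos _).ne' (hpost _).ne']
    constructor <;> intro h <;> linarith
  have hset : {q : ℕ × ℕ | exp (-v) < lam q.1 * lamt q.2}
      = ((Finset.range n ×ˢ Finset.range n).filter
        fun q => -log (lam q.1) + -log (lamt q.2) < v : Finset (ℕ × ℕ)) := by
    ext q
    simp only [mem_ofPred_eq, Finset.coe_filter, Finset.mem_product, Finset.mem_range, hiff]
    refine ⟨fun h => ⟨⟨?_, ?_⟩, h⟩, fun h => h.2⟩
    · by_contra hk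
      have h1 := hn₁ q.1 (hn.trans (not_lt.1 hk))
      rw [← Real.log_lt_iff_lt_exp (hpos _)] at h1
      linarith [hDt q.2]
    · by_contra hk
      have h1 := hn₂ q.2 (hn'.trans (not_lt.1 hk))
      rw [← Real.log_lt_iff_lt_exp (hpost _)] at h1
      linarith [hD q.1]
  unfold cntTensor
  rw [hset, Nat.card_coe_set_eq, Set.ncard_coe_finset, Finset.card_filter]
  push_cast
  rfl

theorem step_mul_step_eq_indicator (a b x v : ℝ) :
    (if a < v then (1:ℝ) else 0) * (if b < x - v then (1:ℝ) else 0)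
      = (Ioo a (x - b)).indicator (fun _ => (1:ℝ)) v := by
  by_cases h1 : a < v <;> by_cases h2 : b < x - v
  · have h3 : v < x - b := by linarith
    simp [h1, h2, h3]
  · have h3 : ¬ v < x - b := fun h => h2 (by linarith)
    simp [h2, h3]
  · simp [h1]
  · simp [h1]

theorem intervalIntegrable_step_mul_step (a b x u w : ℝ) :
    IntervalIntegrable (fun v => (if a < v then (1:ℝ) else 0) * (if b < x - v then (1:ℝ) else 0))
      volume u w := by
  simp only [step_mul_step_eq_indicator]
  rw [intervalIntegrable_iff]
  exact (integrableOn_const (by rw [uIoc]; exact measure_Ioc_lt_top.ne)).indicator measurableSet_Ioo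

theorem integral_step_mul_step {a b x D : ℝ} (ha : -D ≤ a) (hb : -D ≤ b) (hx : -D ≤ x + D) :
    ∫ v in (-D)..(x + D), (if a < v then (1:ℝ) else 0) * (if b < x - v then (1:ℝ) else 0)
      = max 0 (x - (a + b)) := by
  simp only [step_mul_step_eq_indicator]
  rw [intervalIntegral.integral_of_le hx, setIntegral_indicator measurableSet_Ioo]
  have : Ioc (-D) (x + D) ∩ Ioo a (x - b) = Ioo a (x - b) := by
    refine inter_eq_right.2 fun v hv => ⟨by linarith [hv.1], by linarith [hv.2]⟩
  rw [this, setIntegral_const, smul_eq_mul, mul_one, measureReal_def, Real.volume_Ioo,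
    ENNReal.toReal_ofReal', max_comm]
  congr 1; ring

/-- The convolution of the two counting functions is a primitive of the counting function of the
tensor product. -/
theorem cntTensor_bounds_primitive {lam lamt : ℕ → ℝ} (hpos : ∀ n, 0 < lam n)
    (hpost : ∀ n, 0 < lamt n) (hlim : Tendsto lam atTop (nhds 0))
    (hlimt : Tendsto lamt atTop (nhds 0)) {D : ℝ} (hD0 : 0 ≤ D) (hD : ∀ n, -D ≤ -log (lam n))
    (hDt : ∀ n, -D ≤ -log (lamt n)) {J : ℝ → ℝ}
    (hJ : ∀ x, J x = ∫ v in (-D)..(x + D), cntF lam (exp (-v)) * cntF lamt (exp (-(x - v))))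
    (x y : ℝ) (hx : 0 ≤ x) (hxy : x ≤ y) :
    (y - x) * cntTensor lam lamt (exp (-x)) ≤ J y - J x ∧
      J y - J x ≤ (y - x) * cntTensor lam lamt (exp (-y)) := by
  obtain ⟨n, hn, hnt, hnn⟩ := ((cntF_exp_neg_eq_sum hpos hlim (y + D)).and
    ((cntF_exp_neg_eq_sum hpost hlimt (y + D)).and
      (cntTensor_exp_neg_eq_sum hpos hpost hlim hlimt hD hDt y))).exists
  have hJs : ∀ z, 0 ≤ z → z ≤ y → J z = ∑ q ∈ Finset.range n ×ˢ Finset.range n,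
      max 0 (z - (-log (lam q.1) + -log (lamt q.2))) := by
    intro z hz hzy
    have h1 : ∫ v in (-D)..(z + D), cntF lam (exp (-v)) * cntF lamt (exp (-(z - v)))
        = ∫ v in (-D)..(z + D), ∑ q ∈ Finset.range n ×ˢ Finset.range n,
          (if -log (lam q.1) < v then (1:ℝ) else 0)
            * (if -log (lamt q.2) < z - v then (1:ℝ) else 0) := by
      refine intervalIntegral.integral_congr fun v hv => ?_
      rw [uIcc_of_le (by linarith)] at hv
      rw [hn v (by linarith [hv.2]), hnt (z - v) (by linarith [hv.1]), Finset.sum_mul_sum,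
        Finset.sum_product]
    rw [hJ, h1, intervalIntegral.integral_finsetSum fun q _ =>
      intervalIntegrable_step_mul_step _ _ _ _ _]
    exact Finset.sum_congr rfl fun q _ =>
      integral_step_mul_step (hD _) (hDt _) (by linarith)
  rw [hJs x hx hxy, hJs y (hx.trans hxy) le_rfl, hnn x hxy, hnn y le_rfl, ← Finset.sum_sub_distrib,
    Finset.mul_sum, Finset.mul_sum]
  constructor
  · refine Finset.sum_le_sum fun q _ => ?_
    split_ifs with h
    · rw [max_eq_right (by linarith), max_eq_right (by linarith)]; linarith
    · rw [max_eq_left (by linarith : x - _ ≤ 0), mul_zero, sub_zero]; exact le_max_left _ _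
  · refine Finset.sum_le_sum fun q _ => ?_
    split_ifs with h
    · rw [max_eq_right (by linarith : 0 ≤ y - _)]
      linarith [le_max_right 0 (x - (-log (lam q.1) + -log (lamt q.2)))]
    · rw [max_eq_left (by linarith), mul_zero, zero_sub]
      linarith [le_max_left 0 (x - (-log (lam q.1) + -log (lamt q.2)))]

theorem IsSVF.tendsto_comp_exp {φ : ℝ → ℝ} (hφ : IsSVF φ) (δ : ℝ) :
    Tendsto (fun x => φ (exp (x + δ)) / φ (exp x)) atTop (nhds 1) := by
  refine ((hφ.2 (exp δ) (exp_pos δ)).comp tendsto_exp_atTop).congr fun x => ?_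
  simp only [Function.comp_apply, exp_add, mul_comm]

theorem integral_comp_exp_eq {h : ℝ → ℝ} (hh : ∀ σ, 0 < σ → ContinuousAt h σ) (x : ℝ) :
    ∫ u in (0:ℝ)..x, h (exp u) = ∫ σ in (1:ℝ)..exp x, h σ / σ := by
  have h1 := intervalIntegral.integral_comp_mul_deriv' (a := 0) (b := x) (f := exp) (f' := exp)
    (g := fun σ => h σ / σ) (fun y _ => Real.hasDerivAt_exp y) Real.continuous_exp.continuousOn
    (by
      rintro _ ⟨u, _, rfl⟩
      exact ((hh _ (exp_pos u)).div continuousAt_id (exp_pos u).ne').continuousWithinAt)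
  rw [exp_zero] at h1
  rw [← h1]
  congr 1; ext u
  simp only [Function.comp_apply]
  field_simp

theorem IsSVF.logSmooth {φ : ℝ → ℝ} {C : ℝ} (hφ : IsSVF φ) (hφC : ContDiff ℝ 1 φ)
    (hdiv : ¬ IntegrableOn (fun τ => φ τ / τ) (Ici 1) volume)
    (hbound : ∀ σ ≥ (1:ℝ), |σ * Real.log σ * deriv φ σ / φ σ| ≤ C) :
    LogSmooth (fun x => φ (exp x)) C := by
  have hpos : ∀ x, 0 < φ (exp x) := fun x => hφ.1 _ (exp_pos x)
  have hcd : ContDiff ℝ 1 (fun x => φ (exp x)) := hφC.comp Real.contDiff_exp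
  refine ⟨hpos, hcd, fun x hx => ?_, ?_⟩
  · have hd : HasDerivAt (fun x => φ (exp x)) (deriv φ (exp x) * exp x) x :=
      ((hφC.differentiable one_ne_zero (exp x)).hasDerivAt).comp x (Real.hasDerivAt_exp x)
    rw [hd.deriv]
    have h1 := hbound (exp x) (one_le_exp hx)
    rw [log_exp, abs_div, abs_of_pos (hpos x), div_le_iff₀ (hpos x)] at h1
    rwa [show x * (deriv φ (exp x) * exp x) = exp x * x * deriv φ (exp x) by ring]
  · have hmono : Monotone (fun B => ∫ v in (0:ℝ)..B, φ (exp v)) := fun a b hab => by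
      have h1 := intervalIntegral.integral_add_adjacent_intervals (μ := volume)
        (hcd.continuous.intervalIntegrable 0 a) (hcd.continuous.intervalIntegrable a b)
      have h2 : 0 ≤ ∫ v in a..b, φ (exp v) :=
        intervalIntegral.integral_nonneg hab fun v _ => (hpos v).le
      simp only
      linarith
    refine tendsto_atTop_atTop_of_monotone hmono fun K => ?_
    by_contra! hK
    refine hdiv ?_
    rw [integrableOn_Ici_iff_integrableOn_Ioi]
    have hc : ∀ b, ContinuousOn (fun τ => φ τ / τ) (Icc 1 b) := fun b =>
      hφC.continuous.continuousOn.div continuousOn_id fun τ hτ => (one_pos.trans_le hτ.1).ne'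
    refine integrableOn_Ioi_of_intervalIntegral_norm_bounded (b := exp) (l := atTop) K 1
      (fun x => ((hc (exp x)).integrableOn_Icc).mono_set Ioc_subset_Icc_self)
      tendsto_exp_atTop ?_
    filter_upwards [eventually_ge_atTop 0] with x hx
    have h1 := integral_comp_exp_eq (h := φ) (fun σ _ => hφC.continuous.continuousAt) x
    have h2 : ∫ τ in (1:ℝ)..exp x, ‖φ τ / τ‖ = ∫ τ in (1:ℝ)..exp x, φ τ / τ := by
      refine intervalIntegral.integral_congr fun τ hτ => ?_
      rw [uIcc_of_le (one_le_exp hx)] at hτ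
      have hτ0 : 0 < τ := one_pos.trans_le hτ.1
      exact abs_of_pos (div_pos (hφ.1 τ hτ0) hτ0)
    rw [h2, ← h1]
    exact (hK x).le

theorem mellinConv_exp {φ ψ : ℝ → ℝ} (hφ : Continuous φ) (hψ : Continuous ψ) {x : ℝ}
    (hx : 0 ≤ x) :
    mellinConv φ ψ (exp x) = ∫ u in (0:ℝ)..x, φ (exp u) * ψ (exp (x - u)) := by
  have h1 := integral_comp_exp_eq (h := fun σ => φ σ * ψ (exp x / σ))
    (fun σ hσ => hφ.continuousAt.mul
      (ContinuousAt.comp (f := fun σ => exp x / σ) hψ.continuousAt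
        (continuousAt_const.div continuousAt_id hσ.ne'))) x
  rw [mellinConv, ← intervalIntegral.integral_of_le (one_le_exp hx), ← h1]
  simp only [exp_sub]

/-- The convolution of two functions `f`, `g` as above is again slowly varying. -/
theorem LogSmooth.tendsto_conv_shift_of_nonneg {f g : ℝ → ℝ} {C : ℝ} (hf : LogSmooth f C)
    (hg : LogSmooth g C) {δ : ℝ} (hδ : 0 ≤ δ)
    (hfδ : Tendsto (fun x => f (x + δ) / f x) atTop (nhds 1)) :
    Tendsto (fun x => (∫ v in (0:ℝ)..(x + δ), f v * g (x + δ - v))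
      / ∫ v in (0:ℝ)..x, f v * g (x - v)) atTop (nhds 1) := by
  have hbdd : ∀ {h : ℝ → ℝ}, Continuous h → ∀ a A, ∃ K, ∀ v ≤ A, |(Ici a).indicator h v| ≤ K := by
    intro h hh a A
    obtain ⟨K, hK⟩ := (isCompact_Icc (a := a) (b := A)).exists_bound_of_continuousOn hh.continuousOn
    refine ⟨max K 0, fun v hv => ?_⟩
    by_cases hva : a ≤ v
    · rw [indicator_of_mem (mem_Ici.2 hva)]
      exact (hK v ⟨hva, hv⟩).trans (le_max_left _ _)
    · rw [indicator_of_notMem (s := Ici a) (fun hmem => hva hmem), abs_zero]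
      exact le_max_right _ _
  have hfc : Continuous (fun v => f (v + δ)) := hf.continuous.comp (by fun_prop)
  have hα : ModulatedBy ((Ici (-δ)).indicator fun v => f (v + δ)) f (fun _ => 1) := by
    refine ⟨hfc.measurable.indicator measurableSet_Ici, hbdd hfc _, fun ε hε => ?_⟩
    filter_upwards [Metric.tendsto_nhds.1 hfδ ε hε, eventually_ge_atTop (-δ)] with v hv hvδ
    rw [indicator_of_mem (mem_Ici.2 hvδ), mul_one]
    have hfv := hf.pos v
    have e : f (v + δ) - f v = (f (v + δ) / f v - 1) * f v := by field_simp
    rw [e, abs_mul, abs_of_pos hfv]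
    exact mul_le_mul_of_nonneg_right hv.le hfv.le
  have hβ : ModulatedBy ((Ici 0).indicator g) g (fun _ => 1) := by
    refine ⟨hg.continuous.measurable.indicator measurableSet_Ici, hbdd hg.continuous _,
      fun ε hε => ?_⟩
    filter_upwards [eventually_ge_atTop 0] with v hv
    rw [indicator_of_mem (mem_Ici.2 hv), mul_one, sub_self, abs_zero]
    exact (mul_pos hε (hg.pos v)).le
  have hmean : ∀ ε > 0, ∃ K, ∀ x u v : ℝ, u ≤ v →
      |∫ w in u..v, (((fun _ => 1) : ℝ → ℝ) w * ((fun _ => 1) : ℝ → ℝ) (x - w) - 1)|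
        ≤ ε * (v - u) + K := fun ε hε => ⟨0, fun x u v huv => by
    have : 0 ≤ ε * (v - u) := mul_nonneg hε.le (sub_nonneg.2 huv)
    simpa using this⟩
  have hone : ∃ M : ℝ, ∀ x : ℝ, |((fun _ => 1) : ℝ → ℝ) x| ≤ M := ⟨1, fun x => by simp⟩
  have hmain := hα.tendsto_conv_div hf hg hβ continuous_const continuous_const hone hone
    hmean hmean hδ
  refine hmain.congr' ?_
  filter_upwards [eventually_ge_atTop 0] with x hx
  congr 1
  have h1 : ∫ v in (-δ)..x, (Ici (-δ)).indicator (fun v => f (v + δ)) v * (Ici 0).indicator g (x - v)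
      = ∫ v in (-δ)..x, f (v + δ) * g (x - v) := by
    refine intervalIntegral.integral_congr fun v hv => ?_
    rw [uIcc_of_le (by linarith)] at hv
    rw [indicator_of_mem (mem_Ici.2 hv.1), indicator_of_mem (mem_Ici.2 (by linarith [hv.2]))]
  have h2 : ∫ v in x..(x + δ),
      (Ici (-δ)).indicator (fun v => f (v + δ)) v * (Ici 0).indicator g (x - v) = 0 := by
    refine intervalIntegral.integral_zero_ae (Eventually.of_forall fun v hv => ?_)
    rw [uIoc_of_le (by linarith)] at hv
    rw [indicator_of_notMem (s := Ici (0:ℝ)) (fun h => by linarith [hv.1, mem_Ici.1 h]), mul_zero]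
  have h3 : ∫ v in (-δ)..x, f (v + δ) * g (x - v)
      = ∫ v in (0:ℝ)..(x + δ), f v * g (x + δ - v) := by
    have := intervalIntegral.integral_comp_add_right (a := -δ) (b := x)
      (fun v => f v * g (x + δ - v)) δ
    rw [neg_add_cancel] at this
    rw [← this]
    congr 1; ext v
    congr 2; ring
  rw [← intervalIntegral.integral_add_adjacent_intervals
    (hα.intervalIntegrable_mul_reflect hβ x (-δ) x)
    (hα.intervalIntegrable_mul_reflect hβ x x (x + δ)), h1, h2, h3, add_zero]

theorem LogSmooth.tendsto_conv_shift {f g : ℝ → ℝ} {C : ℝ} (hf : LogSmooth f C)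
    (hg : LogSmooth g C) (hfδ : ∀ δ, Tendsto (fun x => f (x + δ) / f x) atTop (nhds 1)) (δ : ℝ) :
    Tendsto (fun x => (∫ v in (0:ℝ)..(x + δ), f v * g (x + δ - v))
      / ∫ v in (0:ℝ)..x, f v * g (x - v)) atTop (nhds 1) := by
  rcases le_total 0 δ with hδ | hδ
  · exact hf.tendsto_conv_shift_of_nonneg hg hδ (hfδ δ)
  · have h1 := (hf.tendsto_conv_shift_of_nonneg hg (neg_nonneg.2 hδ) (hfδ (-δ))).comp
      (tendsto_atTop_add_const_right _ δ tendsto_id)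
    have h2 := h1.inv₀ one_ne_zero
    rw [inv_one] at h2
    refine h2.congr fun x => ?_
    simp only [Function.comp_apply, id_eq, add_neg_cancel_right, inv_div]

theorem finite_setOf_lt_of_tendsto_zero {lam : ℕ → ℝ} (hlim : Tendsto lam atTop (nhds 0)) {t : ℝ}
    (ht : 0 < t) : {n : ℕ | t < lam n}.Finite := by
  obtain ⟨n₀, hn₀⟩ := eventually_atTop.1 (hlim.eventually_lt_const ht)
  refine (finite_Iio n₀).subset fun n hn => ?_
  by_contra h
  exact lt_asymm hn (hn₀ n (not_lt.1 h))

theorem cntF_antitoneOn {lam : ℕ → ℝ} (hlim : Tendsto lam atTop (nhds 0)) :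
    AntitoneOn (cntF lam) (Ioi 0) := by
  intro t ht t' _ htt
  unfold cntF
  exact_mod_cast Nat.card_mono (finite_setOf_lt_of_tendsto_zero hlim ht)
    fun n (hn : t' < lam n) => htt.trans_lt hn

/-- The rescaled counting function `e^{-v/p} N(e^{-v})` is asymptotic to `φ(eᵛ) s(v)`. -/
theorem modulatedBy_cntF {lam : ℕ → ℝ} {φ s : ℝ → ℝ} {p D M : ℝ}
    (hlim : Tendsto lam atTop (nhds 0)) (hp : 0 < p) (hD : ∀ n, lam n ≤ exp D)
    (hφ : ∀ x, 0 < x → 0 < φ x) (hM : ∀ x, |s x| ≤ M)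
    (hN : cntF lam ~[nhdsWithin (0:ℝ) (Ioi 0)]
      (fun t => φ (1 / t) * s (log (1 / t)) / t ^ (1 / p))) :
    ModulatedBy (fun v => exp (-v / p) * cntF lam (exp (-v))) (fun v => φ (exp v)) s := by
  have hmono : Monotone (fun v => cntF lam (exp (-v))) := fun v w hvw =>
    cntF_antitoneOn hlim (exp_pos _) (exp_pos _) (exp_le_exp.2 (neg_le_neg hvw))
  have hnn : ∀ t, 0 ≤ cntF lam t := fun t => Nat.cast_nonneg _
  refine ⟨?_, fun A => ⟨exp (D / p) * cntF lam (exp (-A)), fun v hv => ?_⟩, fun ε hε => ?_⟩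
  · exact Measurable.mul (by fun_prop) hmono.measurable
  · rw [abs_of_nonneg (mul_nonneg (exp_pos _).le (hnn _))]
    by_cases hvD : -D ≤ v
    · refine mul_le_mul (exp_le_exp.2 ?_) (hmono hv) (hnn _) (exp_pos _).le
      exact div_le_div_of_nonneg_right (by linarith) hp.le
    · have hempty : {n : ℕ | exp (-v) < lam n} = ∅ := by
        refine eq_empty_of_forall_notMem fun n (hn : exp (-v) < lam n) => ?_
        have := exp_lt_exp.1 (hn.trans_le (hD n))
        exact hvD (by linarith)
      have h0 : cntF lam (exp (-v)) = 0 := by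
        unfold cntF; rw [hempty]; simp
      rw [h0, mul_zero]
      exact mul_nonneg (exp_pos _).le (hnn _)
  · have hM0 : 0 ≤ M := (abs_nonneg _).trans (hM 0)
    have ht : Tendsto (fun v : ℝ => exp (-v)) atTop (nhdsWithin 0 (Ioi 0)) :=
      tendsto_nhdsWithin_iff.2 ⟨tendsto_exp_neg_atTop_nhds_zero,
        Eventually.of_forall fun v => exp_pos _⟩
    have h1 := ht.eventually (hN.isLittleO.bound (c := ε / (M + 1)) (by positivity))
    filter_upwards [h1] with v hv
    have hrpow : exp (-v) ^ (1 / p) = exp (-v / p) := by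
      rw [← Real.exp_mul]; congr 1; ring
    have hinv : 1 / exp (-v) = exp v := by rw [exp_neg]; simp
    simp only [Pi.sub_apply, hrpow, hinv, log_exp, Real.norm_eq_abs] at hv
    have hE := exp_pos (-v / p)
    have e1 : exp (-v / p) * cntF lam (exp (-v)) - φ (exp v) * s v
        = exp (-v / p) * (cntF lam (exp (-v)) - φ (exp v) * s v / exp (-v / p)) := by
      field_simp
    have hφv := hφ _ (exp_pos v)
    rw [e1, abs_mul, abs_of_pos hE]
    refine (mul_le_mul_of_nonneg_left hv hE.le).trans ?_
    rw [abs_div, abs_mul, abs_of_pos hE, abs_of_pos hφv]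
    have e2 : exp (-v / p) * (ε / (M + 1) * (φ (exp v) * |s v| / exp (-v / p)))
        = ε * φ (exp v) * (|s v| / (M + 1)) := by field_simp
    rw [e2]
    have h3 : |s v| / (M + 1) ≤ 1 := by
      rw [div_le_one (by positivity)]; linarith [hM v]
    have := mul_le_mul_of_nonneg_left h3 (mul_pos hε hφv).le
    linarith

/-- Theorem 5: under the additional bounds
`|σ ln(σ) φ'(σ)/φ(σ)| ≤ C`, `|σ ln(σ) φ̃'(σ)/φ̃(σ)| ≤ C`, with incommensurable
periods, `N_⊗(t) ~ 𝔠 (φ∗φ̃)(1/t)/t^{1/p}` where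
`𝔠 = (1/p)((1/T)∫_0^T s)((1/T̃)∫_0^{T̃} s̃)`. -/
theorem stmt13 (p T Tt C : ℝ) (hp : 0 < p) (hT : 0 < T) (hTt : 0 < Tt)
    (lam lamt : ℕ → ℝ)
    (hpos : ∀ n, 0 < lam n) (hpost : ∀ n, 0 < lamt n)
    (hmono : Antitone lam) (hmonot : Antitone lamt)
    (hsum : Summable lam) (hsumt : Summable lamt)
    (φ φt s st ρ ρt : ℝ → ℝ)
    (hφ : IsSVF φ) (hφt : IsSVF φt)
    (hφC : ContDiff ℝ 1 φ) (hφtC : ContDiff ℝ 1 φt)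
    (hdivφ : ¬ MeasureTheory.IntegrableOn (fun τ => φ τ / τ) (Set.Ici 1)
      MeasureTheory.volume)
    (hdivφt : ¬ MeasureTheory.IntegrableOn (fun τ => φt τ / τ) (Set.Ici 1)
      MeasureTheory.volume)
    (hφbound : ∀ σ ≥ (1:ℝ), |σ * Real.log σ * deriv φ σ / φ σ| ≤ C)
    (hφtbound : ∀ σ ≥ (1:ℝ), |σ * Real.log σ * deriv φt σ / φt σ| ≤ C)
    (hs : Continuous s) (hst : Continuous st)
    (hsper : Function.Periodic s T) (hstper : Function.Periodic st Tt)
    (hsb : ∃ m M : ℝ, 0 < m ∧ ∀ τ, m ≤ s τ ∧ s τ ≤ M)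
    (hstb : ∃ m M : ℝ, 0 < m ∧ ∀ τ, m ≤ st τ ∧ st τ ≤ M)
    (hρ : Monotone ρ) (hρt : Monotone ρt)
    (hρc : Continuous ρ) (hρtc : Continuous ρt)
    (hsform : ∀ τ, s τ = Real.exp (-τ / p) * ρ τ)
    (hstform : ∀ τ, st τ = Real.exp (-τ / p) * ρt τ)
    (hirr : Irrational (T / Tt))
    (hN : cntF lam ~[nhdsWithin (0:ℝ) (Set.Ioi 0)]
      (fun t => φ (1 / t) * s (Real.log (1 / t)) / t ^ (1 / p)))
    (hNt : cntF lamt ~[nhdsWithin (0:ℝ) (Set.Ioi 0)]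
      (fun t => φt (1 / t) * st (Real.log (1 / t)) / t ^ (1 / p))) :
    cntTensor lam lamt ~[nhdsWithin (0:ℝ) (Set.Ioi 0)]
      (fun t => ((1 / p) * ((1 / T) * ∫ x in (0:ℝ)..T, s x) *
          ((1 / Tt) * ∫ x in (0:ℝ)..Tt, st x)) *
        mellinConv φ φt (1 / t) / t ^ (1 / p)) := by
  have hlim : Tendsto lam atTop (nhds 0) := hsum.tendsto_atTop_zero
  have hlimt : Tendsto lamt atTop (nhds 0) := hsumt.tendsto_atTop_zero
  obtain ⟨m₁, M₁, hm₁, hM₁⟩ := hsb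
  obtain ⟨m₂, M₂, hm₂, hM₂⟩ := hstb
  have hsM : ∀ x, |s x| ≤ M₁ := fun x => by
    rw [abs_of_pos (hm₁.trans_le (hM₁ x).1)]; exact (hM₁ x).2
  have hstM : ∀ x, |st x| ≤ M₂ := fun x => by
    rw [abs_of_pos (hm₂.trans_le (hM₂ x).1)]; exact (hM₂ x).2
  have hf := hφ.logSmooth hφC hdivφ hφbound
  have hg := hφt.logSmooth hφtC hdivφt hφtbound
  obtain ⟨D, hD0, hD, hDt⟩ : ∃ D, 0 ≤ D ∧ (∀ n, lam n ≤ exp D) ∧ ∀ n, lamt n ≤ exp D := by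
    refine ⟨max 0 (max (log (lam 0)) (log (lamt 0))), le_max_left _ _, fun n => ?_, fun n => ?_⟩
    · refine (hmono (Nat.zero_le n)).trans ?_
      rw [← log_le_iff_le_exp (hpos 0)]
      exact (le_max_left _ _).trans (le_max_right _ _)
    · refine (hmonot (Nat.zero_le n)).trans ?_
      rw [← log_le_iff_le_exp (hpost 0)]
      exact (le_max_right _ _).trans (le_max_right _ _)
  have hα := modulatedBy_cntF hlim hp hD hφ.1 hsM hN
  have hβ := modulatedBy_cntF hlimt hp hDt hφt.1 hstM hNt
  set ms := (1 / T) * ∫ x in (0:ℝ)..T, s x with hms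
  set mt := (1 / Tt) * ∫ x in (0:ℝ)..Tt, st x with hmt
  have hms0 : 0 < ms := mul_pos (by positivity)
    (intervalIntegral.intervalIntegral_pos_of_pos (hs.intervalIntegrable _ _)
      (fun x => hm₁.trans_le (hM₁ x).1) hT)
  have hmt0 : 0 < mt := mul_pos (by positivity)
    (intervalIntegral.intervalIntegral_pos_of_pos (hst.intervalIntegrable _ _)
      (fun x => hm₂.trans_le (hM₂ x).1) hTt)
  have hirr' : Irrational (Tt / T) := by
    rw [← inv_div]; exact irrational_inv_iff.2 hirr
  have hconv := hα.tendsto_conv_div (m := ms * mt) hf hg hβ hs hst ⟨M₁, hsM⟩ ⟨M₂, hstM⟩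
    (fun ε hε => exists_bound_integral_mul_sub_mean hT hTt hs hst hsper hstper hsM hirr hε)
    (fun ε hε => by
      have := exists_bound_integral_mul_sub_mean hTt hT hst hs hstper hsper hstM hirr' hε
      rwa [mul_comm (1 / Tt * _)] at this) hD0
  set K : ℝ → ℝ := fun x => ∫ v in (0:ℝ)..x, φ (exp v) * φt (exp (x - v)) with hK
  have hKpos : ∀ x, 0 < x → 0 < K x := fun x hx =>
    intervalIntegral.intervalIntegral_pos_of_pos
      (Continuous.intervalIntegrable
        (hf.continuous.mul (hg.continuous.comp (continuous_const.sub continuous_id))) _ _)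
      (fun v => mul_pos (hf.pos v) (hg.pos (x - v))) hx
  set J : ℝ → ℝ := fun x =>
    ∫ v in (-D)..(x + D), cntF lam (exp (-v)) * cntF lamt (exp (-(x - v))) with hJ
  have hJ' : ∀ x, ∫ v in (-D)..(x + D), (exp (-v / p) * cntF lam (exp (-v)))
      * (exp (-(x - v) / p) * cntF lamt (exp (-(x - v)))) = exp (-x / p) * J x := by
    intro x
    rw [hJ, ← intervalIntegral.integral_const_mul]
    congr 1; ext v
    have : exp (-x / p) = exp (-v / p) * exp (-(x - v) / p) := by
      rw [← exp_add]; congr 1; ring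
    rw [this]; ring
  have hlogD : ∀ {l : ℕ → ℝ}, (∀ n, 0 < l n) → (∀ n, l n ≤ exp D) → ∀ n, -D ≤ -log (l n) :=
    fun hl h n => neg_le_neg ((log_le_iff_le_exp (hl n)).2 (h n))
  have hFQ : Tendsto (fun x => cntTensor lam lamt (exp (-x)) / (exp (x / p) * K x)) atTop
      (nhds (ms * mt / p)) := by
    refine tendsto_div_of_primitive_tendsto_div (J := J) ?_
      (cntTensor_bounds_primitive hpos hpost hlim hlimt hD0 (hlogD hpos hD) (hlogD hpost hDt)
        fun _ => rfl) ?_ fun δ => ?_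
    · filter_upwards [eventually_gt_atTop 0] with x hx
      exact mul_pos (exp_pos _) (hKpos x hx)
    · refine hconv.congr fun x => ?_
      rw [hJ' x, neg_div, exp_neg]
      field_simp
      rfl
    · have h1 := (hf.tendsto_conv_shift hg hφ.tendsto_comp_exp δ).const_mul (exp (δ / p))
      rw [mul_one] at h1
      refine h1.congr fun x => ?_
      rw [add_div, exp_add, mul_comm (exp (x / p)), mul_assoc, mul_div_assoc,
        mul_div_mul_left _ _ (exp_pos _).ne']
  have hc : 0 < ms * mt / p := by positivity
  have hlog : Tendsto (fun t : ℝ => -log t) (nhdsWithin 0 (Ioi 0)) atTop :=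
    tendsto_neg_atBot_atTop.comp tendsto_log_nhdsGT_zero
  have hratio := (hFQ.comp hlog).div_const (ms * mt / p)
  rw [div_self hc.ne'] at hratio
  have hev : ∀ᶠ t in nhdsWithin (0:ℝ) (Ioi 0), 0 < t ∧ 0 < -log t :=
    eventually_mem_nhdsWithin.and (hlog.eventually_gt_atTop 0)
  have heq : ∀ t, 0 < t → 0 < -log t → ((1 / p) * ms * mt) * mellinConv φ φt (1 / t) / t ^ (1 / p)
      = ms * mt / p * (exp (-log t / p) * K (-log t)) := by
    intro t ht hlt
    have h1 : 1 / t = exp (-log t) := by rw [exp_neg, exp_log ht, one_div]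
    have h2 : t ^ (1 / p) = (exp (-log t / p))⁻¹ := by
      rw [rpow_def_of_pos ht, ← exp_neg]; congr 1; ring
    rw [h2, h1, mellinConv_exp hφC.continuous hφtC.continuous hlt.le, div_inv_eq_mul]
    ring
  refine (isEquivalent_iff_tendsto_one ?_).2 (hratio.congr' ?_)
  · filter_upwards [hev] with t ht
    rw [heq t ht.1 ht.2]
    exact (mul_pos hc (mul_pos (exp_pos _) (hKpos _ ht.2))).ne'
  · filter_upwards [hev] with t ht
    rw [Pi.div_apply, heq t ht.1 ht.2]
    simp only [Function.comp_apply, neg_neg, exp_log ht.1]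
    rw [div_div, mul_comm (ms * mt / p)]
end
end

section
/- Assume ∫_1^∞ φ(τ) dτ/τ = ∫_1^∞ φ̃(τ) dτ/τ = ∞, the periods T and T̃ of s and s̃ are incommensurable, and there is a constant C such that |σ·ln(σ)·φ'(σ)/φ(σ)| ≤ C and |σ·ln(σ)·φ̃'(σ)/φ̃(σ)| ≤ C for all σ ≥ 1. Then, as τ → ∞: H[φs, φ̃s̃](τ) = (𝔠 + o(1))·h_{φ̃,φ}(τ), H₁[φs, φ̃s̃](τ) = (𝔠 + o(1))·h_{φ,φ̃}(τ), and hence (φs ∗ φ̃s̃)(τ) ~ 𝔠·(φ∗φ̃)(τ), where 𝔠 = (1/p)·((1/T)∫_0^T s(t) dt)·((1/T̃)∫_0^{T̃} s̃(t) dt). -/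
open MeasureTheory Filter Real Set Asymptotics

noncomputable section

theorem weyl_fourier {T : ℝ} [Fact (0 < T)] {α : AddCircle T} (hα : ∀ n : ℤ, n ≠ 0 → n • α ≠ 0)
    (n : ℤ) (hn : n ≠ 0) (N : ℕ) (x : AddCircle T) :
    ‖∑ k ∈ Finset.range N, fourier n (x + k • α)‖ ≤ 2 / ‖fourier n α - 1‖ := by
  have hne : fourier n α ≠ 1 := by
    intro h
    rw [fourier_apply] at h
    have : n • α = 0 := by
      apply AddCircle.injective_toCircle (Fact.out : 0 < T).ne'
      rw [AddCircle.toCircle_zero]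
      exact Circle.ext (by simpa using h)
    exact hα n hn this
  have hsum : ∑ k ∈ Finset.range N, fourier n (x + k • α)
      = fourier n x * ((fourier n α ^ N - 1) / (fourier n α - 1)) := by
    rw [← geom_sum_eq hne, Finset.mul_sum]
    refine Finset.sum_congr rfl fun k _ => ?_
    have : fourier n (k • α) = fourier n α ^ k := by
      simp only [fourier_apply]
      rw [smul_comm, AddCircle.toCircle_nsmul]
      simp
    rw [← this]
    simp only [fourier_apply, smul_add, AddCircle.toCircle_add, Circle.coe_mul]
  have h1 : ∀ y : AddCircle T, ‖fourier n y‖ = 1 := fun y => by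
    rw [fourier_apply, Circle.norm_coe]
  rw [hsum, norm_mul, norm_div, h1, one_mul]
  gcongr
  calc _ ≤ ‖fourier n α ^ N‖ + ‖(1 : ℂ)‖ := norm_sub_le _ _
    _ = 2 := by rw [norm_pow, h1]; norm_num

/-- `F` has uniform ergodic averages along the rotation by `α`. -/
def UniformMean {T : ℝ} [Fact (0 < T)] (α : AddCircle T) (F : C(AddCircle T, ℂ)) : Prop :=
  ∀ ε > 0, ∃ N₀ : ℕ, ∀ N ≥ N₀, ∀ x,
    ‖∑ k ∈ Finset.range N, F (x + k • α) - N * ∫ y, F y ∂AddCircle.haarAddCircle‖ ≤ ε * N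

theorem integrable_haar {T : ℝ} [Fact (0 < T)] (F : C(AddCircle T, ℂ)) :
    Integrable (fun y => F y) (AddCircle.haarAddCircle (T := T)) :=
  F.continuous.integrable_of_hasCompactSupport (HasCompactSupport.of_compactSpace _)

theorem UniformMean.of_fourier {T : ℝ} [Fact (0 < T)] {α : AddCircle T}
    (hα : ∀ n : ℤ, n ≠ 0 → n • α ≠ 0) (n : ℤ) : UniformMean α (fourier n) := by
  intro ε hε
  have hint : ∫ y, fourier n y ∂(AddCircle.haarAddCircle (T := T)) = if n = 0 then 1 else 0 := by
    have := congrFun (fourierCoeff_fourier (T := T) n) 0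
    simpa [fourierCoeff, Pi.single_apply, eq_comm] using this
  rcases eq_or_ne n 0 with rfl | hn
  · refine ⟨0, fun N _ x => ?_⟩
    rw [hint]
    simp
    positivity
  · obtain ⟨N₀, hN₀⟩ := exists_nat_ge (2 / ‖fourier n α - 1‖ / ε)
    refine ⟨N₀, fun N hN x => ?_⟩
    rw [hint, if_neg hn, mul_zero, sub_zero]
    refine (weyl_fourier hα n hn N x).trans ?_
    rw [div_le_iff₀ hε] at hN₀
    refine hN₀.trans ?_
    rw [mul_comm]
    gcongr

theorem UniformMean.add {T : ℝ} [Fact (0 < T)] {α : AddCircle T} {F G : C(AddCircle T, ℂ)}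
    (hF : UniformMean α F) (hG : UniformMean α G) : UniformMean α (F + G) := by
  intro ε hε
  obtain ⟨N₁, h₁⟩ := hF (ε / 2) (by positivity)
  obtain ⟨N₂, h₂⟩ := hG (ε / 2) (by positivity)
  refine ⟨max N₁ N₂, fun N hN x => ?_⟩
  have e₁ := h₁ N (le_of_max_le_left hN) x
  have e₂ := h₂ N (le_of_max_le_right hN) x
  simp only [ContinuousMap.add_apply]
  rw [integral_add (integrable_haar F) (integrable_haar G), Finset.sum_add_distrib, mul_add,
    add_sub_add_comm]
  exact (norm_add_le _ _).trans (by linarith)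

theorem UniformMean.smul {T : ℝ} [Fact (0 < T)] {α : AddCircle T} {F : C(AddCircle T, ℂ)}
    (c : ℂ) (hF : UniformMean α F) : UniformMean α (c • F) := by
  intro ε hε
  obtain ⟨N₁, h₁⟩ := hF (ε / (‖c‖ + 1)) (by positivity)
  refine ⟨N₁, fun N hN x => ?_⟩
  have e₁ := h₁ N hN x
  simp only [ContinuousMap.smul_apply]
  rw [integral_smul, ← Finset.smul_sum, mul_smul_comm, ← smul_sub, norm_smul]
  calc _ ≤ (‖c‖ + 1) * (ε / (‖c‖ + 1) * N) := by gcongr; linarith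
    _ = ε * N := by field_simp

theorem UniformMean.of_dense {T : ℝ} [Fact (0 < T)] {α : AddCircle T} {F : C(AddCircle T, ℂ)}
    (h : ∀ ε > 0, ∃ G, ‖F - G‖ ≤ ε ∧ UniformMean α G) : UniformMean α F := by
  intro ε hε
  obtain ⟨G, hFG, hG⟩ := h (ε / 3) (by positivity)
  obtain ⟨N₁, h₁⟩ := hG (ε / 3) (by positivity)
  refine ⟨N₁, fun N hN x => ?_⟩
  have e₁ := h₁ N hN x
  have hpt : ∀ y, ‖F y - G y‖ ≤ ε / 3 := fun y => ((F - G).norm_coe_le_norm y).trans hFG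
  have e₂ : ‖∑ k ∈ Finset.range N, (F (x + k • α) - G (x + k • α))‖ ≤ ε / 3 * N := by
    refine (norm_sum_le_of_le _ fun k _ => hpt _).trans ?_
    simp [mul_comm]
  have e₃ : ‖∫ y, (F y - G y) ∂(AddCircle.haarAddCircle (T := T))‖ ≤ ε / 3 := by
    refine (norm_integral_le_of_norm_le_const (.of_forall hpt)).trans ?_
    simp
  rw [integral_sub (integrable_haar F) (integrable_haar G)] at e₃
  rw [Finset.sum_sub_distrib] at e₂
  set a := ∑ k ∈ Finset.range N, F (x + k • α)
  set b := ∑ k ∈ Finset.range N, G (x + k • α)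
  set c := ∫ y, F y ∂(AddCircle.haarAddCircle (T := T))
  set d := ∫ y, G y ∂(AddCircle.haarAddCircle (T := T))
  have : a - N * c = (a - b) + (b - N * d) - N * (c - d) := by ring
  rw [this]
  have e₄ : ‖(N : ℂ) * (c - d)‖ ≤ N * (ε / 3) := by
    rw [norm_mul, Complex.norm_natCast]; gcongr
  calc _ ≤ ‖a - b‖ + ‖b - N * d‖ + ‖(N : ℂ) * (c - d)‖ :=
        (norm_sub_le _ _).trans (by gcongr; exact norm_add_le _ _)
    _ ≤ ε * N := by linarith

theorem uniformMean_of_zsmul_ne_zero {T : ℝ} [Fact (0 < T)] {α : AddCircle T}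
    (hα : ∀ n : ℤ, n ≠ 0 → n • α ≠ 0) (F : C(AddCircle T, ℂ)) : UniformMean α F := by
  refine .of_dense fun ε hε => ?_
  have hF : F ∈ (Submodule.span ℂ (range <| @fourier T)).topologicalClosure := by
    rw [span_fourier_closure_eq_top]; trivial
  obtain ⟨G, hG, hd⟩ := Metric.mem_closure_iff.1 hF ε hε
  refine ⟨G, by rw [← dist_eq_norm]; exact hd.le, ?_⟩
  clear hd
  induction hG using Submodule.span_induction with
  | mem x h => obtain ⟨n, rfl⟩ := h; exact .of_fourier hα n
  | zero => intro ε hε; exact ⟨0, fun N _ x => by simp; positivity⟩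
  | add x y _ _ hx hy => exact hx.add hy
  | smul a x _ hx => exact hx.smul a

/-- Uniform Weyl equidistribution of the translates by `Tt` of a `T`-periodic function. -/
theorem uniform_average {T Tt : ℝ} (hT : 0 < T) (hirr : Irrational (T / Tt)) {s : ℝ → ℝ}
    (hs : Continuous s) (hper : Function.Periodic s T) {ε : ℝ} (hε : 0 < ε) :
    ∃ N : ℕ, 0 < N ∧ ∀ u, |∑ k ∈ Finset.range N, s (u - k * Tt)
      - N * ((1 / T) * ∫ x in (0:ℝ)..T, s x)| ≤ ε * N := by
  have : Fact (0 < T) := ⟨hT⟩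
  have hperC : Function.Periodic (fun x => (s x : ℂ)) T := fun x => by simp [hper x]
  have hcont : Continuous hperC.lift := by
    refine continuous_coinduced_dom.2 ?_
    exact Complex.continuous_ofReal.comp hs
  let F : C(AddCircle T, ℂ) := ⟨hperC.lift, hcont⟩
  have hF : ∀ x : ℝ, F (x : AddCircle T) = s x := fun x => hperC.lift_coe x
  have hα : ∀ n : ℤ, n ≠ 0 → n • ((-Tt : ℝ) : AddCircle T) ≠ 0 := by
    intro n hn h
    rw [← AddCircle.coe_zsmul, AddCircle.coe_eq_zero_iff] at h
    obtain ⟨m, hm⟩ := h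
    simp only [zsmul_eq_mul] at hm
    have hTt : Tt ≠ 0 := by rintro rfl; simp at hirr
    have hm0 : (m : ℝ) ≠ 0 := by
      intro h0
      rw [h0, zero_mul] at hm
      have : (n : ℝ) ≠ 0 := by exact_mod_cast hn
      simp_all
    apply hirr
    refine ⟨(-n / m : ℚ), ?_⟩
    push_cast
    field_simp
    linarith
  have hmean : ∫ y, F y ∂(AddCircle.haarAddCircle (T := T))
      = (((1 / T) * ∫ x in (0:ℝ)..T, s x : ℝ) : ℂ) := by
    have := fourierCoeff_eq_intervalIntegral F 0 0
    simp [fourierCoeff, hF] at this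
    rw [this]
    push_cast
    rw [← intervalIntegral.integral_ofReal, one_div]
  obtain ⟨N, hN⟩ := uniformMean_of_zsmul_ne_zero hα F ε hε
  refine ⟨N + 1, by omega, fun u => ?_⟩
  have := hN (N + 1) (by omega) u
  rw [hmean] at this
  convert this using 1
  rw [← Real.norm_eq_abs, ← Complex.norm_real]
  push_cast
  congr 2
  refine Finset.sum_congr rfl fun k _ => ?_
  rw [← AddCircle.coe_nsmul, ← AddCircle.coe_add, hF]
  congr 2
  simp [sub_eq_add_neg]

theorem exp_image_Ioi_zero : exp '' Ioi 0 = Ioi 1 := by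
  ext y
  simp only [mem_image, mem_Ioi]
  exact ⟨fun ⟨x, hx, h⟩ => h ▸ one_lt_exp_iff.2 hx, fun h =>
    ⟨log y, log_pos h, exp_log (by linarith)⟩⟩

theorem exp_image_Ioc (a b : ℝ) : exp '' Ioc a b = Ioc (exp a) (exp b) := by
  ext y
  simp only [mem_image, mem_Ioc]
  constructor
  · rintro ⟨x, ⟨h1, h2⟩, rfl⟩
    exact ⟨exp_lt_exp.2 h1, exp_le_exp.2 h2⟩
  · rintro ⟨h1, h2⟩
    have hy : 0 < y := (exp_pos a).trans h1
    exact ⟨log y, ⟨(lt_log_iff_exp_lt hy).2 h1, (log_le_iff_le_exp hy).2 h2⟩, exp_log hy⟩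

theorem IsLogStieltjes.comap_exp {μ : Measure ℝ} {ρ : ℝ → ℝ} (h : IsLogStieltjes μ ρ) :
    IsStieltjesOf (μ.comap exp) ρ := by
  intro a b hab
  rw [isOpenEmbedding_exp.measurableEmbedding.comap_apply, exp_image_Ioc,
    h _ _ (exp_pos a) (exp_le_exp.2 hab), log_exp, log_exp]

theorem IsStieltjesOf.ext {μ ν : Measure ℝ} {ρ : ℝ → ℝ} (hμ : IsStieltjesOf μ ρ)
    (hν : IsStieltjesOf ν ρ) : μ = ν := by
  have : IsLocallyFiniteMeasure μ := ⟨fun x => ⟨Ioc (x - 1) (x + 1),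
    Ioc_mem_nhds (by linarith) (by linarith), by
      rw [hμ _ _ (by linarith)]; exact ENNReal.ofReal_lt_top⟩⟩
  exact Measure.ext_of_Ioc _ _ fun a b hab => by rw [hμ _ _ hab.le, hν _ _ hab.le]

theorem IsStieltjesOf.isLocallyFiniteMeasure {μ : Measure ℝ} {ρ : ℝ → ℝ}
    (hμ : IsStieltjesOf μ ρ) : IsLocallyFiniteMeasure μ :=
  ⟨fun x => ⟨Ioc (x - 1) (x + 1), Ioc_mem_nhds (by linarith) (by linarith), by
      rw [hμ _ _ (by linarith)]; exact ENNReal.ofReal_lt_top⟩⟩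

theorem IsStieltjesOf.nullSingletonClass {μ : Measure ℝ} {ρ : ℝ → ℝ} (hμ : IsStieltjesOf μ ρ)
    (hρ : Continuous ρ) : NullSingletonClass μ := by
  refine ⟨fun a => ?_⟩
  have hle : ∀ h > 0, μ {a} ≤ ENNReal.ofReal (ρ a - ρ (a - h)) := fun h hh => by
    rw [← hμ _ _ (by linarith)]
    exact measure_mono (by simpa using hh)
  have hlim : Tendsto (fun h => ENNReal.ofReal (ρ a - ρ (a - h))) (nhdsWithin 0 (Ioi 0))
      (nhds 0) := by
    have : Continuous fun h => ENNReal.ofReal (ρ a - ρ (a - h)) :=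
      ENNReal.continuous_ofReal.comp (by fun_prop)
    have h0 := this.tendsto 0
    simp only [sub_zero, sub_self, ENNReal.ofReal_zero] at h0
    exact h0.mono_left nhdsWithin_le_nhds
  have := ge_of_tendsto hlim (eventually_mem_nhdsWithin.mono fun h hh => hle h hh)
  exact le_antisymm this bot_le

/-- Partial integration of `exp (-x / p)` against the Stieltjes measure of `exp (x / p) * st x`. -/
theorem integral_exp_stieltjes {ν : Measure ℝ} {st ρ : ℝ → ℝ} {p : ℝ} (hp : 0 < p)
    (hν : IsStieltjesOf ν ρ) (hρ : Monotone ρ) (hst : Continuous st)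
    (hform : ∀ x, st x = exp (-x / p) * ρ x) (a b : ℝ) :
    ∫ x in a..b, exp (-x / p) ∂ν = st b - st a + (1 / p) * ∫ x in a..b, st x := by
  have hρst : ∀ x, ρ x = exp (x / p) * st x := fun x => by
    rw [hform, ← mul_assoc, ← exp_add]; simp [neg_div]
  have hρc : Continuous ρ := by rw [funext hρst]; fun_prop
  have := hν.isLocallyFiniteMeasure
  have := hν.nullSingletonClass hρc
  have hint : ∀ a b, IntervalIntegrable (fun x => exp (-x / p)) ν a b := fun a b =>
    Continuous.intervalIntegrable (by fun_prop) a b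
  have hreal : ∀ x y, x ≤ y → ν.real (Ioc x y) = ρ y - ρ x := fun x y hxy => by
    rw [measureReal_def, hν _ _ hxy, ENNReal.toReal_ofReal (sub_nonneg.2 (hρ hxy))]
  have hlow : ∀ x y, x ≤ y → exp (-y / p) * (ρ y - ρ x) ≤ ∫ x in x..y, exp (-x / p) ∂ν := by
    intro x y hxy
    rw [← hreal x y hxy, intervalIntegral.integral_of_le hxy]
    have : ∫ u in Ioc x y, exp (-y / p) ∂ν = exp (-y / p) * ν.real (Ioc x y) := by
      simp [mul_comm]
    rw [← this]
    refine setIntegral_mono_on (continuous_const.intervalIntegrable x y).1 (hint x y).1 measurableSet_Ioc fun u hu => ?_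
    have := hu.2
    gcongr
  have hupp : ∀ x y, x ≤ y → ∫ x in x..y, exp (-x / p) ∂ν ≤ exp (-x / p) * (ρ y - ρ x) := by
    intro x y hxy
    rw [← hreal x y hxy, intervalIntegral.integral_of_le hxy]
    have : ∫ u in Ioc x y, exp (-x / p) ∂ν = exp (-x / p) * ν.real (Ioc x y) := by
      simp [mul_comm]
    rw [← this]
    refine setIntegral_mono_on (hint x y).1 (continuous_const.intervalIntegrable x y).1 measurableSet_Ioc fun u hu => ?_
    have := hu.1.le
    gcongr
  set P : ℝ → ℝ := fun x => ∫ u in a..x, exp (-u / p) ∂ν with hP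
  have hPc : Continuous P := intervalIntegral.continuous_primitive hint a
  have hPsub : ∀ x y, P y - P x = ∫ u in x..y, exp (-u / p) ∂ν := fun x y =>
    intervalIntegral.integral_interval_sub_left (hint a y) (hint a x)
  have hderiv : ∀ x, HasDerivWithinAt (fun y => P y - st y) (1 / p * st x) (Ioi x) x := by
    intro x
    rw [hasDerivWithinAt_iff_tendsto_slope' (by simp)]
    have hu1 : HasDerivAt (fun y => -exp (-(y - x) / p)) (1 / p) x := by
      have : HasDerivAt (fun y => -(y - x) / p) (-1 / p) x :=
        (((hasDerivAt_id x).sub_const x).neg).div_const p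
      exact this.exp.neg.congr_deriv (by simp [neg_div])
    have hu2 : HasDerivAt (fun y => exp ((y - x) / p)) (1 / p) x := by
      have : HasDerivAt (fun y => (y - x) / p) (1 / p) x :=
        ((hasDerivAt_id x).sub_const x).div_const p
      convert this.exp using 1
      simp
    have h1 := ((hasDerivAt_iff_tendsto_slope.1 hu1).mono_left
      (nhdsWithin_mono x (fun y (hy : y ∈ Ioi x) => ne_of_gt hy))).mul_const (st x)
    have h2 := ((hasDerivAt_iff_tendsto_slope.1 hu2).mono_left
      (nhdsWithin_mono x (fun y (hy : y ∈ Ioi x) => ne_of_gt hy))).mul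
        ((hst.tendsto x).mono_left (nhdsWithin_le_nhds (s := Ioi x)))
    refine tendsto_of_tendsto_of_tendsto_of_le_of_le' h1 h2 ?_ ?_
    · filter_upwards [self_mem_nhdsWithin] with y (hy : x < y)
      have := hlow x y hy.le
      rw [← hPsub, mul_sub, ← hform, hρst x, ← mul_assoc, ← exp_add] at this
      rw [slope_def_field, slope_def_field, div_mul_eq_mul_div]
      have hyx : 0 < y - x := sub_pos.2 hy
      gcongr
      have e : -y / p + x / p = -(y - x) / p := by ring
      rw [e] at this
      simp only [sub_self, neg_zero, zero_div, exp_zero]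
      linarith
    · filter_upwards [self_mem_nhdsWithin] with y (hy : x < y)
      have := hupp x y hy.le
      rw [← hPsub, mul_sub, ← hform, hρst y, ← mul_assoc, ← exp_add] at this
      rw [slope_def_field, slope_def_field, div_mul_eq_mul_div]
      have hyx : 0 < y - x := sub_pos.2 hy
      gcongr
      have e : -x / p + y / p = (y - x) / p := by ring
      rw [e] at this
      simp only [sub_self, zero_div, exp_zero]
      linarith
  have hftc := intervalIntegral.integral_eq_sub_of_hasDeriv_right (a := a) (b := b)
    (f := fun y => P y - st y) (hPc.sub hst).continuousOn (fun x _ => hderiv x)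
    (Continuous.intervalIntegrable (by fun_prop) a b)
  rw [intervalIntegral.integral_const_mul] at hftc
  have hPa : P a = 0 := by simp [hP]
  have hPb : P b = ∫ x in a..b, exp (-x / p) ∂ν := rfl
  simp only [hPa, hPb] at hftc
  linarith

theorem IsStieltjesOf.withDensity_exp {ν : Measure ℝ} {st ρ : ℝ → ℝ} {p : ℝ} (hp : 0 < p)
    (hν : IsStieltjesOf ν ρ) (hρ : Monotone ρ) (hst : Continuous st)
    (hform : ∀ x, st x = exp (-x / p) * ρ x) :
    IsStieltjesOf (ν.withDensity fun x => ENNReal.ofReal (exp (-x / p)))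
      (fun x => st x + (1 / p) * ∫ u in (0:ℝ)..x, st u) := by
  intro a b hab
  have := hν.isLocallyFiniteMeasure
  have hc : Continuous fun x : ℝ => exp (-x / p) := by fun_prop
  rw [withDensity_apply _ measurableSet_Ioc, ← ofReal_integral_eq_lintegral_ofReal
    ((hc.intervalIntegrable a b).1) (.of_forall fun x => (exp_pos _).le),
    ← intervalIntegral.integral_of_le hab, integral_exp_stieltjes hp hν hρ hst hform,
    ← intervalIntegral.integral_interval_sub_left (hst.intervalIntegrable 0 b)
      (hst.intervalIntegrable 0 a)]
  congr 1
  ring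

theorem IsStieltjesOf.map_add_right {μ : Measure ℝ} {st : ℝ → ℝ} {p Tt : ℝ}
    (hst : Continuous st) (hper : Function.Periodic st Tt)
    (hμ : IsStieltjesOf μ (fun x => st x + (1 / p) * ∫ u in (0:ℝ)..x, st u)) :
    MeasurePreserving (fun x => x + Tt) μ μ := by
  refine ⟨by fun_prop, IsStieltjesOf.ext (fun a b hab => ?_) hμ⟩
  rw [Measure.map_apply (by fun_prop) measurableSet_Ioc, preimage_add_const_Ioc,
    hμ _ _ (by linarith)]
  beta_reduce
  rw [hper.sub_eq, hper.sub_eq]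
  have h1 : ∀ x, ∫ u in (0:ℝ)..x - Tt, st u = ∫ u in Tt..x, st u := fun x => by
    have := intervalIntegral.integral_comp_sub_right (a := Tt) (b := x) st Tt
    rw [sub_self] at this
    rw [← this]
    exact intervalIntegral.integral_congr fun u _ => (hper.sub_eq u)
  rw [h1, h1]
  have h2 : ∀ x, ∫ u in Tt..x, st u = (∫ u in (0:ℝ)..x, st u) - ∫ u in (0:ℝ)..Tt, st u :=
    fun x => (intervalIntegral.integral_interval_sub_left (hst.intervalIntegrable 0 x)
      (hst.intervalIntegrable 0 Tt)).symm
  rw [h2, h2]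
  congr 1
  ring

theorem integral_translates_near_mean {m : Measure ℝ} [IsLocallyFiniteMeasure m] {Tt M S ε : ℝ}
    (hTt : 0 < Tt) (hm : ∀ k : ℕ, MeasurePreserving (fun x => x + k * Tt) m m)
    (hM : ∀ a, m.real (Ioc a (a + Tt)) = M) {s : ℝ → ℝ} (hs : Continuous s) {N : ℕ}
    (hN : ∀ u, |∑ k ∈ Finset.range N, s (u - k * Tt) - N * S| ≤ ε * N) (η a : ℝ) :
    |∫ x in a..a + N * Tt, s (η - x) ∂m - N * S * M| ≤ ε * N * M := by
  have hint : ∀ k : ℕ, ∀ a b, IntervalIntegrable (fun x => s (η - x - k * Tt)) m a b :=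
    fun k a b => Continuous.intervalIntegrable (by fun_prop) a b
  have hint0 : ∀ a b, IntervalIntegrable (fun x => s (η - x)) m a b :=
    fun a b => Continuous.intervalIntegrable (by fun_prop) a b
  have hblock : ∀ k : ℕ, ∫ x in (a + k * Tt)..(a + (k + 1 : ℕ) * Tt), s (η - x) ∂m
      = ∫ x in a..a + Tt, s (η - x - k * Tt) ∂m := by
    intro k
    rw [intervalIntegral.integral_of_le (by push_cast; nlinarith),
      intervalIntegral.integral_of_le (by linarith),
      ← (hm k).setIntegral_preimage_emb (measurableEmbedding_addRight _),
      preimage_add_const_Ioc]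
    have e : a + (k + 1 : ℕ) * Tt - k * Tt = a + Tt := by push_cast; ring
    rw [e, add_sub_cancel_right]
    refine integral_congr_ae (.of_forall fun x => ?_)
    simp only [sub_sub]
  have hsum := intervalIntegral.sum_integral_adjacent_intervals (μ := m)
    (f := fun x => s (η - x)) (a := fun k : ℕ => a + k * Tt) (n := N) fun k _ => hint0 _ _
  simp only [Nat.cast_zero, zero_mul, add_zero] at hsum
  rw [← hsum, Finset.sum_congr rfl fun k _ => hblock k,
    ← intervalIntegral.integral_finsetSum fun k _ => hint k _ _,
    intervalIntegral.integral_of_le (by linarith)]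
  have hconst : ∫ x in Ioc a (a + Tt), (N * S : ℝ) ∂m = N * S * M := by
    simp [hM, mul_comm]
  rw [← hconst, ← integral_sub, ← Real.norm_eq_abs]
  · rw [← hM a]
    exact norm_setIntegral_le_of_norm_le_const measure_Ioc_lt_top fun x _ => hN (η - x)
  · exact (Continuous.intervalIntegrable (by fun_prop) a (a + Tt)).1
  · exact (continuous_const.intervalIntegrable a (a + Tt)).1

theorem abs_integral_sub_const_mul_le {μ : Measure ℝ} [IsLocallyFiniteMeasure μ] {w : ℝ → ℝ}
    (hw : Continuous w) {a b v ε : ℝ} (hab : a ≤ b) (h : ∀ x ∈ Ioc a b, |w x - v| ≤ ε * v) :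
    |∫ x in a..b, w x ∂μ - v * μ.real (Ioc a b)| ≤ ε * v * μ.real (Ioc a b) := by
  have hconst : ∫ x in Ioc a b, v ∂μ = v * μ.real (Ioc a b) := by simp [mul_comm]
  rw [intervalIntegral.integral_of_le hab, ← hconst, ← integral_sub (hw.intervalIntegrable a b).1
    (continuous_const.intervalIntegrable a b).1, ← Real.norm_eq_abs]
  exact norm_setIntegral_le_of_norm_le_const measure_Ioc_lt_top h

theorem abs_integral_sub_le_of_block {κ : Measure ℝ} [IsLocallyFiniteMeasure κ] {w : ℝ → ℝ}
    (hw : Continuous w) {a L v c ε : ℝ} (hL : 0 < L) (hc : 0 ≤ c) (hv : 0 < v) (hε : 0 < ε)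
    (hε' : ε ≤ 1 / 2) (h : ∀ x ∈ Ioc a (a + L), |w x - v| ≤ ε * v)
    (hκ : |κ.real (Ioc a (a + L)) - c * L| ≤ ε * L) :
    |∫ x in a..a + L, w x ∂κ - c * ∫ x in a..a + L, w x|
      ≤ 4 * (c + 1) * ε * ∫ x in a..a + L, w x := by
  have h1 := abs_integral_sub_const_mul_le (μ := κ) hw (by linarith) h
  have h2 := abs_integral_sub_const_mul_le (μ := volume) hw (by linarith) h
  have hvol : volume.real (Ioc a (a + L)) = L := by simp [hL.le]
  rw [hvol] at h2
  set A := ∫ x in a..a + L, w x ∂κ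
  set I := ∫ x in a..a + L, w x
  set k := κ.real (Ioc a (a + L))
  have hvL : 0 < v * L := by positivity
  have hI : v * L / 2 ≤ I := by
    have := (abs_le.1 h2).1
    nlinarith
  have hk : k ≤ (c + 1 / 2) * L := by
    have := (abs_le.1 hκ).2
    nlinarith
  have hdec : A - c * I = (A - v * k) + v * (k - c * L) - c * (I - v * L) := by ring
  calc |A - c * I| ≤ |A - v * k| + |v * (k - c * L)| + |c * (I - v * L)| := by
        rw [hdec]; exact (abs_sub _ _).trans (by gcongr; exact abs_add_le _ _)
    _ ≤ ε * v * ((c + 1 / 2) * L) + v * (ε * L) + c * (ε * v * L) := by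
        rw [abs_mul, abs_mul, abs_of_pos hv, abs_of_nonneg hc]
        gcongr
        exact h1.trans (by gcongr)
    _ ≤ 4 * (c + 1) * ε * (v * L / 2) := by nlinarith [mul_pos hε hvL]
    _ ≤ _ := by gcongr

theorem abs_integral_sub_le_of_blocks {κ : Measure ℝ} [IsLocallyFiniteMeasure κ] {w : ℝ → ℝ}
    (hw : Continuous w) {a L c K : ℝ} (n : ℕ)
    (h : ∀ k < n, |∫ x in (a + k * L)..(a + k * L + L), w x ∂κ
      - c * ∫ x in (a + k * L)..(a + k * L + L), w x|
        ≤ K * ∫ x in (a + k * L)..(a + k * L + L), w x) :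
    |∫ x in a..a + n * L, w x ∂κ - c * ∫ x in a..a + n * L, w x|
      ≤ K * ∫ x in a..a + n * L, w x := by
  induction n with
  | zero => simp
  | succ n ih =>
    have ih := ih fun k hk => h k (by omega)
    have hn := h n (by omega)
    have e : a + (n + 1 : ℕ) * L = a + n * L + L := by push_cast; ring
    rw [e, ← intervalIntegral.integral_add_adjacent_intervals (μ := κ)
      (hw.intervalIntegrable a (a + n * L)) (hw.intervalIntegrable _ _),
      ← intervalIntegral.integral_add_adjacent_intervals (μ := volume)
      (hw.intervalIntegrable a (a + n * L)) (hw.intervalIntegrable _ _)]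
    rw [mul_add, mul_add, add_sub_add_comm]
    exact (abs_add_le _ _).trans (add_le_add ih hn)

theorem le_exp_mul_of_log_le {u v t : ℝ} (hu : 0 < u) (hv : 0 < v) (h : log u - log v ≤ t) :
    u ≤ exp t * v := by
  rw [← log_le_log_iff hu (by positivity), log_mul (exp_pos t).ne' hv.ne', log_exp]
  linarith

theorem abs_sub_le_of_abs_log_sub_le {u v t : ℝ} (hu : 0 < u) (hv : 0 < v)
    (h : |log u - log v| ≤ t) (ht : t ≤ 1) : |u - v| ≤ 2 * t * v := by
  have e : u - v = (exp (log u - log v) - 1) * v := by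
    rw [exp_sub, exp_log hu, exp_log hv]; field_simp
  rw [e, abs_mul, abs_of_pos hv]
  gcongr
  exact (abs_exp_sub_one_le (h.trans ht)).trans (by linarith)

theorem log_sub_log_le {x y : ℝ} (hx : 0 < x) (hy : 0 < y) : log y - log x ≤ (y - x) / x := by
  rw [← log_div hy.ne' hx.ne']
  refine (log_le_sub_one_of_pos (by positivity)).trans (le_of_eq ?_)
  field_simp

theorem measureReal_Ioc_mul_le {κ : Measure ℝ} [IsLocallyFiniteMeasure κ] {c L ε : ℝ}
    (h : ∀ a, |κ.real (Ioc a (a + L)) - c * L| ≤ ε * L) (n : ℕ) :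
    κ.real (Ioc 0 (n * L)) ≤ n * ((c + ε) * L) := by
  induction n with
  | zero => simp
  | succ n ih =>
    have hb := (abs_le.1 (h (n * L))).2
    have hsub : Ioc (0:ℝ) ((n + 1 : ℕ) * L) ⊆ Ioc 0 (n * L) ∪ Ioc (n * L) (n * L + L) := by
      intro x hx
      push_cast at hx
      rcases le_or_gt x (n * L) with h | h
      · exact .inl ⟨hx.1, h⟩
      · exact .inr ⟨h, by linarith [hx.2]⟩
    have := (measureReal_mono hsub (measure_union_lt_top measure_Ioc_lt_top
      measure_Ioc_lt_top).ne).trans (measureReal_union_le (μ := κ) _ _)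
    rw [Nat.cast_succ, add_one_mul] at *
    linarith

set_option maxHeartbeats 1000000 in
theorem isLittleO_weighted_integral {F G : ℝ → ℝ} {C c : ℝ} (hC : 0 ≤ C) (hc : 0 ≤ c)
    (hF : Continuous F) (hG : Continuous G) (hFpos : ∀ x, 0 < F x) (hGpos : ∀ x, 0 < G x)
    (hFlog : ∀ x y, 0 < x → x ≤ y → |log (F y) - log (F x)| ≤ C * (log y - log x))
    (hGlog : ∀ x y, 0 < x → x ≤ y → |log (G y) - log (G x)| ≤ C * (log y - log x))
    (hdiv : Tendsto (fun R => ∫ x in (0:ℝ)..R, G x) atTop atTop)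
    (κ : ℝ → Measure ℝ) (hκf : ∀ η, IsLocallyFiniteMeasure (κ η))
    (hκ : ∀ ε > 0, ∃ L > 0, ∀ η a, |(κ η).real (Ioc a (a + L)) - c * L| ≤ ε * L) :
    (fun η => ∫ x in (0:ℝ)..η / 2, G x * F (η - x) ∂κ η
      - c * ∫ x in (0:ℝ)..η / 2, G x * F (η - x))
      =o[atTop] fun η => ∫ x in (0:ℝ)..η / 2, G x * F (η - x) := by
  rw [isLittleO_iff]
  intro δ hδ
  obtain ⟨ε, hε, hε', hεδ⟩ : ∃ ε > 0, ε ≤ 1 / 2 ∧ 4 * (c + 1) * ε ≤ δ / 2 := by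
    refine ⟨min (1 / 2) (δ / (8 * (c + 1))), by positivity, min_le_left _ _, ?_⟩
    calc 4 * (c + 1) * min (1 / 2) (δ / (8 * (c + 1))) ≤ 4 * (c + 1) * (δ / (8 * (c + 1))) := by
          gcongr; exact min_le_right _ _
      _ = δ / 2 := by field_simp; norm_num
  obtain ⟨L, hL, hκL⟩ := hκ ε hε
  obtain ⟨J, hJ⟩ := exists_nat_gt (4 * C / ε)
  have hJ0 : (0 : ℝ) < J := lt_of_le_of_lt (by positivity) hJ
  rw [div_lt_iff₀ hε] at hJ
  set R : ℝ := J * L with hR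
  have hRpos : 0 < R := by positivity
  obtain ⟨B, hB⟩ : ∃ B, ∀ x ∈ Icc 0 (R + L), G x ≤ B :=
    (isCompact_Icc.bddAbove_image hG.continuousOn).imp fun B hB x hx => hB ⟨x, hx, rfl⟩
  have hBpos : 0 < B := (hGpos 0).trans_le (hB 0 ⟨le_rfl, by positivity⟩)
  set E : ℝ := (J + 1) * ((c + ε) * L) with hE
  have hκE : ∀ η, (κ η).real (Ioc 0 (R + L)) ≤ E := by
    intro η
    have := hκf η
    have := measureReal_Ioc_mul_le (hκL η) (J + 1)
    have e : ((J + 1 : ℕ) : ℝ) * L = R + L := by push_cast; ring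
    rw [e] at this
    simpa [hE] using this
  set H : ℝ := B * exp C * E + c * (B * exp C * (R + L)) with hH
  have hdiv2 := hdiv.comp (tendsto_id.atTop_div_const (show (0:ℝ) < 2 by norm_num))
  filter_upwards [eventually_ge_atTop (2 * (R + L)),
    hdiv2.eventually_ge_atTop (H * exp C * (2 / δ))] with η hη hηH
  have hκη := hκf η
  simp only [Function.comp_apply, id] at hηH
  set w : ℝ → ℝ := fun x => G x * F (η - x) with hw
  have hwc : Continuous w := by fun_prop
  have hwpos : ∀ x, 0 < w x := fun x => mul_pos (hGpos _) (hFpos _)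
  have hη0 : 0 < η := by linarith
  have hFη : ∀ x, 0 ≤ x → x ≤ η / 2 → |log (F η) - log (F (η - x))| ≤ C := by
    intro x hx hx'
    refine (hFlog _ _ (by linarith) (by linarith)).trans ?_
    have := log_sub_log_le (x := η - x) (y := η) (by linarith) hη0
    have h1 : (η - (η - x)) / (η - x) ≤ 1 := by rw [div_le_one (by linarith)]; linarith
    exact mul_le_of_le_one_right hC (this.trans h1)
  -- lower bound for the total integral
  have hlow : exp (-C) * F η * ∫ x in (0:ℝ)..η / 2, G x ≤ ∫ x in (0:ℝ)..η / 2, w x := by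
    rw [← intervalIntegral.integral_const_mul]
    refine intervalIntegral.integral_mono_on (by linarith)
      (Continuous.intervalIntegrable (by fun_prop) _ _) (hwc.intervalIntegrable _ _)
      fun x hx => ?_
    have := le_exp_mul_of_log_le (hFpos η) (hFpos (η - x)) (abs_le.1 (hFη x hx.1 hx.2)).2
    have h2 : exp (-C) * F η ≤ F (η - x) := by
      rw [exp_neg, inv_mul_le_iff₀ (exp_pos C)]; exact this
    rw [mul_comm (exp (-C) * F η)]
    exact mul_le_mul_of_nonneg_left h2 (hGpos x).le
  have hwhead : ∀ x, 0 ≤ x → x ≤ R + L → w x ≤ B * exp C * F η := by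
    intro x hx hx'
    have h1 := hB x ⟨hx, hx'⟩
    have h2 := le_exp_mul_of_log_le (hFpos (η - x)) (hFpos η) (t := C)
      (by linarith [(abs_le.1 (hFη x hx (by linarith))).1])
    calc w x ≤ B * (exp C * F η) := mul_le_mul h1 h2 (hFpos _).le hBpos.le
      _ = _ := by ring
  -- the splitting point
  set n : ℕ := ⌊(η / 2 - R) / L⌋₊ with hn
  set a : ℝ := η / 2 - n * L with ha
  have hn1 : n * L ≤ η / 2 - R := by
    rw [← le_div_iff₀ hL]; exact Nat.floor_le (div_nonneg (by linarith) hL.le)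
  have hn2 : η / 2 - R < (n + 1) * L := by
    rw [← div_lt_iff₀ hL]; exact Nat.lt_floor_add_one _
  have haR : R ≤ a := by linarith
  have haRL : a ≤ R + L := by linarith
  have haη : a + n * L = η / 2 := by rw [ha]; ring
  have hblocks := abs_integral_sub_le_of_blocks (κ := κ η) hwc (a := a) (L := L) (c := c)
    (K := 4 * (c + 1) * ε) n fun k hk => by
      have hk1 : (k : ℝ) + 1 ≤ n := by exact_mod_cast hk
      have hkL : (k : ℝ) * L + L ≤ n * L := by nlinarith
      have hkL0 : 0 ≤ (k : ℝ) * L := by positivity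
      set b := a + k * L with hb
      have hbR : R ≤ b := by linarith
      have hbη : b + L ≤ η / 2 := by linarith
      refine abs_integral_sub_le_of_block hwc hL hc (hwpos b) hε hε' (fun x hx => ?_) (hκL η b)
      have hxb := hx.1
      have hxL := hx.2
      have hlog : |log (w x) - log (w b)| ≤ 2 * (C / J) := by
        have g1 : |log (G x) - log (G b)| ≤ C / J := by
          refine (hGlog b x (by linarith) hxb.le).trans ?_
          rw [div_eq_mul_one_div C]
          gcongr
          refine (log_sub_log_le (by linarith) (by linarith)).trans ?_
          rw [div_le_div_iff₀ (by linarith) hJ0]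
          nlinarith
        have g2 : |log (F (η - x)) - log (F (η - b))| ≤ C / J := by
          rw [abs_sub_comm]
          refine (hFlog (η - x) (η - b) (by linarith) (by linarith)).trans ?_
          rw [div_eq_mul_one_div C]
          gcongr
          refine (log_sub_log_le (by linarith) (by linarith)).trans ?_
          rw [div_le_div_iff₀ (by linarith) hJ0]
          nlinarith
        simp only [hw]
        rw [log_mul (hGpos _).ne' (hFpos _).ne', log_mul (hGpos _).ne' (hFpos _).ne',
          add_sub_add_comm]
        exact (abs_add_le _ _).trans (by linarith)
      have hCJ : 4 * (C / J) ≤ ε := by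
        rw [← mul_div_assoc, div_le_iff₀ hJ0]; linarith
      have := abs_sub_le_of_abs_log_sub_le (hwpos x) (hwpos b) hlog (by linarith)
      refine this.trans ?_
      have := (hwpos b).le
      gcongr
      linarith
  rw [haη] at hblocks
  have ha0 : 0 ≤ a := hRpos.le.trans haR
  -- the head
  have hhead : ∀ (μ : Measure ℝ) [IsLocallyFiniteMeasure μ],
      |∫ x in (0:ℝ)..a, w x ∂μ| ≤ B * exp C * F η * μ.real (Ioc 0 (R + L)) := by
    intro μ _
    rw [intervalIntegral.integral_of_le ha0, ← Real.norm_eq_abs]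
    refine (norm_setIntegral_le_of_norm_le_const (C := B * exp C * F η) measure_Ioc_lt_top
      fun x hx => ?_).trans ?_
    · rw [Real.norm_eq_abs, abs_of_pos (hwpos x)]
      exact hwhead x hx.1.le (hx.2.trans haRL)
    · have := (hFpos η).le
      gcongr
      exact measure_Ioc_lt_top.ne
  have hhead1 := hhead (κ η)
  have hhead2 := hhead volume
  have hvol : volume.real (Ioc 0 (R + L)) = R + L := by simp; positivity
  rw [hvol] at hhead2
  have hheadH : |∫ x in (0:ℝ)..a, w x ∂κ η - c * ∫ x in (0:ℝ)..a, w x| ≤ H * F η := by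
    refine (abs_sub _ _).trans ?_
    rw [abs_mul, abs_of_nonneg hc]
    have hFη0 := (hFpos η).le
    calc _ ≤ B * exp C * F η * E + c * (B * exp C * F η * (R + L)) := by
          gcongr
          exact hhead1.trans (by gcongr; exact hκE η)
      _ = H * F η := by rw [hH]; ring
  have hW : 0 ≤ ∫ x in (0:ℝ)..a, w x :=
    intervalIntegral.integral_nonneg ha0 fun x _ => (hwpos x).le
  have hsplit := intervalIntegral.integral_add_adjacent_intervals (μ := κ η)
    (hwc.intervalIntegrable 0 a) (hwc.intervalIntegrable a (η / 2))
  have hsplit' := intervalIntegral.integral_add_adjacent_intervals (μ := volume)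
    (hwc.intervalIntegrable 0 a) (hwc.intervalIntegrable a (η / 2))
  have hHF : H * F η ≤ δ / 2 * ∫ x in (0:ℝ)..η / 2, w x := by
    calc H * F η = δ / 2 * (exp (-C) * F η * (H * exp C * (2 / δ))) := by
          rw [exp_neg]; field_simp
      _ ≤ δ / 2 * (exp (-C) * F η * ∫ x in (0:ℝ)..η / 2, G x) := by
          have := (hFpos η).le
          gcongr
      _ ≤ _ := by gcongr
  have hW2 : 0 ≤ ∫ x in a..η / 2, w x :=
    intervalIntegral.integral_nonneg (by linarith) fun x _ => (hwpos x).le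
  have hWtot : 0 ≤ ∫ x in (0:ℝ)..η / 2, w x := by
    rw [← hsplit']; exact add_nonneg hW hW2
  rw [Real.norm_eq_abs, Real.norm_eq_abs, abs_of_nonneg hWtot, ← hsplit]
  calc _ = |(∫ x in (0:ℝ)..a, w x ∂κ η - c * ∫ x in (0:ℝ)..a, w x)
        + (∫ x in a..η / 2, w x ∂κ η - c * ∫ x in a..η / 2, w x)| := by
        rw [← hsplit']; congr 1; ring
    _ ≤ H * F η + 4 * (c + 1) * ε * ∫ x in a..η / 2, w x :=
        (abs_add_le _ _).trans (add_le_add hheadH hblocks)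
    _ ≤ δ / 2 * (∫ x in (0:ℝ)..η / 2, w x) + δ / 2 * ∫ x in (0:ℝ)..η / 2, w x := by
        gcongr
        linarith
    _ = _ := by ring

theorem abs_log_comp_exp_sub_le {φ : ℝ → ℝ} {C : ℝ} (hpos : ∀ x > 0, 0 < φ x)
    (hφ : ContDiff ℝ 1 φ) (hb : ∀ σ ≥ (1 : ℝ), |σ * log σ * deriv φ σ / φ σ| ≤ C)
    {x y : ℝ} (hx : 0 < x) (hxy : x ≤ y) :
    |log (φ (exp y)) - log (φ (exp x))| ≤ C * (log y - log x) := by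
  have hne : ∀ u, φ (exp u) ≠ 0 := fun u => (hpos _ (exp_pos u)).ne'
  set D : ℝ → ℝ := fun u => deriv φ (exp u) * exp u / φ (exp u) with hD
  have hL : ∀ u, HasDerivAt (fun u => log (φ (exp u))) (D u) u := fun u =>
    (((hφ.differentiable one_ne_zero).differentiableAt.hasDerivAt.comp u
      (hasDerivAt_exp u)).log (hne u))
  have hDb : ∀ u > 0, |D u| ≤ C * u⁻¹ := fun u hu => by
    have h := hb (exp u) (one_le_exp hu.le)
    have he : exp u * log (exp u) * deriv φ (exp u) / φ (exp u) = u * D u := by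
      rw [log_exp, hD]; ring
    rw [he, abs_mul, abs_of_pos hu] at h
    rw [← div_eq_mul_inv, le_div_iff₀ hu]
    linarith
  have key : ∀ e : ℝ, |e| = 1 → C * log x + e * log (φ (exp x)) ≤
      C * log y + e * log (φ (exp y)) := fun e he => by
    have hder : ∀ u > 0, HasDerivAt (fun u => C * log u + e * log (φ (exp u)))
        (C * u⁻¹ + e * D u) u := fun u hu =>
      ((hasDerivAt_log hu.ne').const_mul C).add ((hL u).const_mul e)
    refine monotoneOn_of_hasDerivWithinAt_nonneg (convex_Ioi 0)
      (fun u hu => (hder u hu).continuousAt.continuousWithinAt)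
      (fun u hu => (hder u (interior_subset hu)).hasDerivWithinAt)
      (fun u hu => ?_) hx (hx.trans_le hxy) hxy
    have h1 := hDb u (interior_subset hu)
    have h2 : |e * D u| ≤ C * u⁻¹ := by rwa [abs_mul, he, one_mul]
    linarith [neg_le_of_abs_le h2]
  have h1 := key 1 (by simp)
  have h2 := key (-1) (by simp)
  rw [abs_le]
  constructor <;> linarith

theorem tendsto_integral_comp_exp_atTop {φ : ℝ → ℝ} (hpos : ∀ x > 0, 0 < φ x)
    (hφ : Continuous φ) (hdiv : ¬ IntegrableOn (fun τ => φ τ / τ) (Ici 1)) :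
    Tendsto (fun R => ∫ x in (0:ℝ)..R, φ (exp x)) atTop atTop := by
  have hc : Continuous fun x => φ (exp x) := by fun_prop
  have hp : ∀ x, 0 < φ (exp x) := fun x => hpos _ (exp_pos x)
  have hmono : Monotone fun R => ∫ x in (0:ℝ)..R, φ (exp x) := fun a b hab => by
    rw [← sub_nonneg, intervalIntegral.integral_interval_sub_left (hc.intervalIntegrable _ _)
      (hc.intervalIntegrable _ _)]
    exact intervalIntegral.integral_nonneg hab fun x _ => (hp x).le
  refine (tendsto_atTop_of_monotone hmono).resolve_right ?_
  rintro ⟨l, hl⟩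
  refine hdiv ?_
  rw [integrableOn_Ici_iff_integrableOn_Ioi, ← exp_image_Ioi_zero,
    integrableOn_image_iff_integrableOn_abs_deriv_smul measurableSet_Ioi
      (fun x _ => (hasDerivAt_exp x).hasDerivWithinAt) exp_injective.injOn]
  have heq : (fun x => |exp x| • (φ (exp x) / exp x)) = fun x => φ (exp x) := by
    ext x
    rw [abs_of_pos (exp_pos x), smul_eq_mul, mul_div_cancel₀ _ (exp_pos x).ne']
  rw [heq]
  refine integrableOn_Ioi_of_intervalIntegral_norm_tendsto l 0
    (fun i => (hc.intervalIntegrable 0 i).1) tendsto_id ?_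
  simpa only [Real.norm_eq_abs, abs_of_pos (hp _)] using hl

theorem setIntegral_Ioc_exp_div (h : ℝ → ℝ) {a b : ℝ} (hab : a ≤ b) :
    ∫ σ in Ioc (exp a) (exp b), h σ / σ = ∫ x in a..b, h (exp x) := by
  rw [← exp_image_Ioc, integral_image_eq_integral_abs_deriv_smul measurableSet_Ioc
    (fun x _ => (hasDerivAt_exp x).hasDerivWithinAt) exp_injective.injOn,
    intervalIntegral.integral_of_le hab]
  congr 1 with x
  rw [abs_of_pos (exp_pos x), smul_eq_mul, mul_div_cancel₀ _ (exp_pos x).ne']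

theorem intervalIntegral_reflect (μ : Measure ℝ) [NullSingletonClass μ] (w : ℝ → ℝ) {η : ℝ}
    (hη : 0 ≤ η) : ∫ x in η / 2..η, w x ∂μ =
      ∫ y in (0:ℝ)..η / 2, w (η - y) ∂μ.map (fun x => η - x) := by
  rw [intervalIntegral.integral_of_le (by linarith), intervalIntegral.integral_of_le (by linarith),
    show (fun x => η - x) = Homeomorph.subLeft η from rfl,
    (Homeomorph.subLeft η).measurableEmbedding.setIntegral_map]
  have : (Homeomorph.subLeft η) ⁻¹' Ioc 0 (η / 2) = Ico (η / 2) η := by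
    ext x
    simp only [mem_preimage, Homeomorph.coe_subLeft, mem_Ioc, mem_Ico]
    constructor <;> rintro ⟨h1, h2⟩ <;> constructor <;> linarith
  rw [this, ← integral_Icc_eq_integral_Ioc, ← integral_Icc_eq_integral_Ico]
  simp

theorem map_sub_left_Ioc (μ : Measure ℝ) [NullSingletonClass μ] (η a b : ℝ) :
    μ.map (fun x => η - x) (Ioc a b) = μ (Ioc (η - b) (η - a)) := by
  rw [Measure.map_apply (by fun_prop) measurableSet_Ioc, preimage_const_sub_Ioc]
  exact measure_congr Ico_ae_eq_Ioc

theorem measure_real_withDensity_near_mean {p T Tt : ℝ} {s st : ℝ → ℝ} {m : Measure ℝ}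
    (hp : 0 < p) (hT : 0 < T) (hTt : 0 < Tt) (hirr : Irrational (T / Tt)) (hs : Continuous s)
    (hst : Continuous st) (hsper : Function.Periodic s T) (hstper : Function.Periodic st Tt)
    (hspos : ∀ x, 0 < s x) (hstpos : ∀ x, 0 < st x)
    (hm : IsStieltjesOf m (fun x => st x + (1 / p) * ∫ u in (0:ℝ)..x, st u)) {ε : ℝ}
    (hε : 0 < ε) : ∃ L > 0, ∀ η a,
      |(m.withDensity fun x => ENNReal.ofReal (s (η - x))).real (Ioc a (a + L)) -
        ((1 / p) * ((1 / T) * ∫ x in (0:ℝ)..T, s x) * ((1 / Tt) * ∫ x in (0:ℝ)..Tt, st x)) * L|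
        ≤ ε * L := by
  have := hm.isLocallyFiniteMeasure
  set S := (1 / T) * ∫ x in (0:ℝ)..T, s x with hS
  set M := (1 / p) * ∫ x in (0:ℝ)..Tt, st x with hM
  have hstint : 0 < ∫ x in (0:ℝ)..Tt, st x :=
    intervalIntegral.intervalIntegral_pos_of_pos (hst.intervalIntegrable _ _) hstpos hTt
  have hMpos : 0 < M := by positivity
  have hreal : ∀ a, m.real (Ioc a (a + Tt)) = M := fun a => by
    have hint : (∫ u in (0:ℝ)..a + Tt, st u) - ∫ u in (0:ℝ)..a, st u
        = ∫ u in (0:ℝ)..Tt, st u := by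
      rw [intervalIntegral.integral_interval_sub_left (hst.intervalIntegrable _ _)
        (hst.intervalIntegrable _ _), hstper.intervalIntegral_add_eq a 0, zero_add]
    rw [measureReal_def, hm _ _ (by linarith), ENNReal.toReal_ofReal] <;> beta_reduce <;>
      rw [hstper a, add_sub_add_left_eq_sub, ← mul_sub, hint]
    exact hMpos.le
  obtain ⟨N, hN0, hN⟩ := uniform_average hT hirr hs hsper
    (show 0 < ε * Tt / M by positivity)
  have hNpos : (0 : ℝ) < N := by exact_mod_cast hN0
  refine ⟨N * Tt, by positivity, fun η a => ?_⟩
  have hmp : ∀ k : ℕ, MeasurePreserving (fun x => x + k * Tt) m m := fun k =>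
    IsStieltjesOf.map_add_right hst (hstper.nat_mul k) hm
  have h := integral_translates_near_mean (S := S) hTt hmp hreal hs hN η a
  have hle : a ≤ a + N * Tt := by nlinarith [mul_pos hNpos hTt]
  have hcs : Continuous fun x => s (η - x) := by fun_prop
  have hκ : (m.withDensity fun x => ENNReal.ofReal (s (η - x))).real (Ioc a (a + N * Tt)) =
      ∫ x in a..a + N * Tt, s (η - x) ∂m := by
    rw [measureReal_def, withDensity_apply _ measurableSet_Ioc,
      intervalIntegral.integral_of_le hle,
      integral_eq_lintegral_of_nonneg_ae (.of_forall fun x => (hspos _).le)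
        hcs.aestronglyMeasurable]
  rw [hκ]
  have e1 : 1 / p * S * ((1 / Tt) * ∫ x in (0:ℝ)..Tt, st x) * (N * Tt) = N * S * M := by
    rw [hM]; field_simp
  have e2 : ε * Tt / M * N * M = ε * (N * Tt) := by field_simp
  rw [e1, ← e2]
  exact h

theorem almostMellinOn_exp {φ φt s st ρt : ℝ → ℝ} {μt : Measure ℝ} {p : ℝ}
    (hs : Continuous s) (hspos : ∀ x, 0 < s x) (hstpos : ∀ x, 0 < st x)
    (hstform : ∀ τ, st τ = exp (-τ / p) * ρt τ) {a b : ℝ} (hab : a ≤ b) (η : ℝ) :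
    almostMellinOn (Ioc (exp a) (exp b)) φ φt s st ρt μt (exp η) =
      ∫ x in a..b, φt (exp x) * φ (exp (η - x))
        ∂((μt.comap exp).withDensity fun x => ENNReal.ofReal (exp (-x / p))).withDensity
          fun x => ENNReal.ofReal (s (η - x)) := by
  have hemb := isOpenEmbedding_exp.measurableEmbedding
  have hsub : Ioc (exp a) (exp b) ⊆ range exp := fun y hy => by
    rw [range_exp]; exact (exp_pos a).trans hy.1
  rw [intervalIntegral.integral_of_le hab,
    setIntegral_withDensity_eq_setIntegral_toReal_smul (by fun_prop)
      (.of_forall fun x => ENNReal.ofReal_lt_top) _ measurableSet_Ioc,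
    setIntegral_withDensity_eq_setIntegral_toReal_smul (by fun_prop)
      (.of_forall fun x => ENNReal.ofReal_lt_top) _ measurableSet_Ioc,
    almostMellinOn, ← Measure.restrict_restrict_of_subset hsub, ← hemb.map_comap,
    hemb.setIntegral_map, ← exp_image_Ioc, exp_injective.preimage_image]
  congr 1 with x
  have hρ : ρt x ≠ 0 := fun h => (hstpos x).ne' (by rw [hstform, h, mul_zero])
  rw [ENNReal.toReal_ofReal (exp_pos _).le, ENNReal.toReal_ofReal (hspos _).le, log_exp,
    ← exp_sub, log_exp, hstform, smul_eq_mul, smul_eq_mul]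
  field_simp

/-- under divergence of both SVF integrals, incommensurable periods and
the bounds `|σ ln(σ) φ'(σ)/φ(σ)| ≤ C`, `|σ ln(σ) φ̃'(σ)/φ̃(σ)| ≤ C`, one has
`H[φs, φ̃s̃](τ) = (𝔠 + o(1)) h_{φ̃,φ}(τ)`, `H₁[φs, φ̃s̃](τ) = (𝔠 + o(1)) h_{φ,φ̃}(τ)`
and `(φs ∗ φ̃s̃)(τ) ~ 𝔠 (φ∗φ̃)(τ)` as `τ → ∞`. -/
theorem stmt14 (p T Tt C : ℝ) (hp : 0 < p) (hT : 0 < T) (hTt : 0 < Tt)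
    (φ φt s st ρ ρt : ℝ → ℝ) (μt : MeasureTheory.Measure ℝ)
    (hφ : IsSVF φ) (hφt : IsSVF φt)
    (hφC : ContDiff ℝ 1 φ) (hφtC : ContDiff ℝ 1 φt)
    (hdivφ : ¬ MeasureTheory.IntegrableOn (fun τ => φ τ / τ) (Set.Ici 1)
      MeasureTheory.volume)
    (hdivφt : ¬ MeasureTheory.IntegrableOn (fun τ => φt τ / τ) (Set.Ici 1)
      MeasureTheory.volume)
    (hφbound : ∀ σ ≥ (1:ℝ), |σ * Real.log σ * deriv φ σ / φ σ| ≤ C)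
    (hφtbound : ∀ σ ≥ (1:ℝ), |σ * Real.log σ * deriv φt σ / φt σ| ≤ C)
    (hs : Continuous s) (hst : Continuous st)
    (hsper : Function.Periodic s T) (hstper : Function.Periodic st Tt)
    (hsb : ∃ m M : ℝ, 0 < m ∧ ∀ τ, m ≤ s τ ∧ s τ ≤ M)
    (hstb : ∃ m M : ℝ, 0 < m ∧ ∀ τ, m ≤ st τ ∧ st τ ≤ M)
    (hρ : Monotone ρ) (hρt : Monotone ρt)
    (hρc : Continuous ρ) (hρtc : Continuous ρt)
    (hsform : ∀ τ, s τ = Real.exp (-τ / p) * ρ τ)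
    (hstform : ∀ τ, st τ = Real.exp (-τ / p) * ρt τ)
    (hμt : IsLogStieltjes μt ρt)
    (hirr : Irrational (T / Tt)) :
    ((fun τ => almostH φ φt s st ρt μt τ -
        ((1 / p) * ((1 / T) * ∫ x in (0:ℝ)..T, s x) *
          ((1 / Tt) * ∫ x in (0:ℝ)..Tt, st x)) * mellinH φt φ τ)
      =o[atTop] mellinH φt φ) ∧
    ((fun τ => almostH1 φ φt s st ρt μt τ -
        ((1 / p) * ((1 / T) * ∫ x in (0:ℝ)..T, s x) *
          ((1 / Tt) * ∫ x in (0:ℝ)..Tt, st x)) * mellinH φ φt τ)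
      =o[atTop] mellinH φ φt) ∧
    (almostMellin φ φt s st ρt μt ~[atTop]
      (fun τ => ((1 / p) * ((1 / T) * ∫ x in (0:ℝ)..T, s x) *
          ((1 / Tt) * ∫ x in (0:ℝ)..Tt, st x)) * mellinConv φ φt τ)) := by
  obtain ⟨ms, _, hms0, hms⟩ := hsb
  obtain ⟨mt, _, hmt0, hmt⟩ := hstb
  have hspos : ∀ x, 0 < s x := fun x => hms0.trans_le (hms x).1
  have hstpos : ∀ x, 0 < st x := fun x => hmt0.trans_le (hmt x).1
  have hC : 0 ≤ C := (abs_nonneg _).trans (hφbound 1 le_rfl)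
  set c := (1 / p) * ((1 / T) * ∫ x in (0:ℝ)..T, s x) * ((1 / Tt) * ∫ x in (0:ℝ)..Tt, st x)
  have hc : 0 < c := by
    have h1 : 0 < ∫ x in (0:ℝ)..T, s x :=
      intervalIntegral.intervalIntegral_pos_of_pos (hs.intervalIntegrable _ _) hspos hT
    have h2 : 0 < ∫ x in (0:ℝ)..Tt, st x :=
      intervalIntegral.intervalIntegral_pos_of_pos (hst.intervalIntegrable _ _) hstpos hTt
    positivity
  have hν := hμt.comap_exp
  have hνf := hν.isLocallyFiniteMeasure
  have hνa := hν.nullSingletonClass hρtc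
  have hm := hν.withDensity_exp hp hρt hst hstform
  have hmf := hm.isLocallyFiniteMeasure
  set m := (μt.comap exp).withDensity fun x => ENNReal.ofReal (exp (-x / p))
  have hma : NullSingletonClass m := nullSingletonClass_withDensity _
  set κ : ℝ → Measure ℝ := fun η => m.withDensity fun x => ENNReal.ofReal (s (η - x))
  have hκf : ∀ η, IsLocallyFiniteMeasure (κ η) := fun η =>
    IsLocallyFiniteMeasure.withDensity_ofReal (by fun_prop)
  have hκa : ∀ η, NullSingletonClass (κ η) := fun η => nullSingletonClass_withDensity _
  have hκ : ∀ ε > 0, ∃ L > 0, ∀ η a, |(κ η).real (Ioc a (a + L)) - c * L| ≤ ε * L :=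
    fun ε hε => measure_real_withDensity_near_mean hp hT hTt hirr hs hst hsper hstper hspos
      hstpos hm hε
  set κ' : ℝ → Measure ℝ := fun η => (κ η).map fun x => η - x with hκ'def
  have hκ'f : ∀ η, IsLocallyFiniteMeasure (κ' η) := fun η =>
    ⟨fun x => ⟨Ioc (x - 1) (x + 1), Ioc_mem_nhds (by linarith) (by linarith), by
      rw [map_sub_left_Ioc]; exact measure_Ioc_lt_top⟩⟩
  have hκ' : ∀ ε > 0, ∃ L > 0, ∀ η a, |(κ' η).real (Ioc a (a + L)) - c * L| ≤ ε * L := by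
    intro ε hε
    obtain ⟨L, hL, h⟩ := hκ ε hε
    refine ⟨L, hL, fun η a => ?_⟩
    have := h η (η - (a + L))
    rwa [show η - (a + L) + L = η - a by ring, measureReal_def, ← map_sub_left_Ioc] at this
  have hφc := hφC.continuous
  have hφtc := hφtC.continuous
  have hfpos : ∀ x, 0 < φ (exp x) := fun x => hφ.1 _ (exp_pos x)
  have hgpos : ∀ x, 0 < φt (exp x) := fun x => hφt.1 _ (exp_pos x)
  have hfc : Continuous fun x => φ (exp x) := by fun_prop
  have hgc : Continuous fun x => φt (exp x) := by fun_prop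
  have hflog := fun x y => abs_log_comp_exp_sub_le hφ.1 hφC hφbound (x := x) (y := y)
  have hglog := fun x y => abs_log_comp_exp_sub_le hφt.1 hφtC hφtbound (x := x) (y := y)
  have h1 := isLittleO_weighted_integral hC hc.le hfc hgc hfpos
    hgpos hflog hglog (tendsto_integral_comp_exp_atTop hφt.1 hφtc hdivφt) κ hκf hκ
  have h2 := isLittleO_weighted_integral hC hc.le hgc hfc hgpos
    hfpos hglog hflog (tendsto_integral_comp_exp_atTop hφ.1 hφc hdivφ) κ' hκ'f hκ'
  have hH : ∀ η ≥ 0, almostH φ φt s st ρt μt (exp η) =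
      ∫ x in (0:ℝ)..η / 2, φt (exp x) * φ (exp (η - x)) ∂κ η := fun η hη => by
    rw [almostH, ← exp_half, ← exp_zero,
      almostMellinOn_exp hs hspos hstpos hstform (by linarith)]
  have hH1' : ∀ η ≥ 0, almostH1 φ φt s st ρt μt (exp η) =
      ∫ x in η / 2..η, φt (exp x) * φ (exp (η - x)) ∂κ η := fun η hη => by
    rw [almostH1, ← exp_half, almostMellinOn_exp hs hspos hstpos hstform (by linarith)]
  have hH1 : ∀ η ≥ 0, almostH1 φ φt s st ρt μt (exp η) =
      ∫ x in (0:ℝ)..η / 2, φ (exp x) * φt (exp (η - x)) ∂κ' η := fun η hη => by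
    rw [hH1' η hη, intervalIntegral_reflect _ _ hη]
    simp only [sub_sub_cancel, mul_comm (φt _), hκ'def]
  have hadd : ∀ η ≥ 0, almostMellin φ φt s st ρt μt (exp η) =
      almostH φ φt s st ρt μt (exp η) + almostH1 φ φt s st ρt μt (exp η) := fun η hη => by
    have hcont : Continuous fun x => φt (exp x) * φ (exp (η - x)) := by fun_prop
    rw [hH η hη, hH1' η hη, intervalIntegral.integral_add_adjacent_intervals
      (hcont.intervalIntegrable _ _) (hcont.intervalIntegrable _ _), almostMellin, ← exp_zero,
      almostMellinOn_exp hs hspos hstpos hstform hη]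
  have hh : ∀ (F G : ℝ → ℝ), ∀ η ≥ 0, mellinH F G (exp η) =
      ∫ x in (0:ℝ)..η / 2, F (exp x) * G (exp (η - x)) := fun F G η hη => by
    rw [mellinH, ← exp_half, ← exp_zero,
      setIntegral_Ioc_exp_div (fun σ => F σ * G (exp η / σ)) (by linarith)]
    simp only [exp_sub]
  have hconv : ∀ η ≥ 0, mellinConv φ φt (exp η) =
      mellinH φt φ (exp η) + mellinH φ φt (exp η) := fun η hη => by
    have hcont : Continuous fun x => φ (exp x) * φt (exp (η - x)) := by fun_prop
    have hrefl := intervalIntegral.integral_comp_sub_left (a := 0) (b := η / 2)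
      (fun x => φ (exp x) * φt (exp (η - x))) η
    rw [sub_zero, sub_half] at hrefl
    simp only [sub_sub_cancel, mul_comm (φ _)] at hrefl
    rw [hh _ _ η hη, hh _ _ η hη, hrefl, add_comm]
    simp only [mul_comm (φt _)]
    rw [intervalIntegral.integral_add_adjacent_intervals
      (hcont.intervalIntegrable _ _) (hcont.intervalIntegrable _ _), mellinConv, ← exp_zero,
      setIntegral_Ioc_exp_div (fun σ => φ σ * φt (exp η / σ)) hη]
    simp only [exp_sub]
  have hhnonneg : ∀ (F G : ℝ → ℝ), (∀ x, 0 < F (exp x)) → (∀ x, 0 < G (exp x)) → ∀ η ≥ 0,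
      0 ≤ mellinH F G (exp η) := fun F G hF hG η hη => by
    rw [hh _ _ η hη]
    exact intervalIntegral.integral_nonneg (by linarith) fun x _ => (mul_pos (hF _) (hG _)).le
  have hev := eventually_ge_atTop (0 : ℝ)
  have k1 : (fun η => almostH φ φt s st ρt μt (exp η) - c * mellinH φt φ (exp η)) =o[atTop]
      fun η => mellinH φt φ (exp η) :=
    h1.congr' (hev.mono fun η hη => by beta_reduce; rw [hH η hη, hh _ _ η hη])
      (hev.mono fun η hη => (hh _ _ η hη).symm)
  have k2 : (fun η => almostH1 φ φt s st ρt μt (exp η) - c * mellinH φ φt (exp η)) =o[atTop]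
      fun η => mellinH φ φt (exp η) :=
    h2.congr' (hev.mono fun η hη => by beta_reduce; rw [hH1 η hη, hh _ _ η hη])
      (hev.mono fun η hη => (hh _ _ η hη).symm)
  have k3 : (fun η => almostMellin φ φt s st ρt μt (exp η) - c * mellinConv φ φt (exp η))
      =o[atTop] fun η => c * mellinConv φ φt (exp η) := by
    have o1 : (fun η => mellinH φt φ (exp η)) =O[atTop] fun η => mellinConv φ φt (exp η) :=
      .of_norm_eventuallyLE (hev.mono fun η hη => by
        have b1 := hhnonneg φt φ hgpos hfpos η hη
        have b2 := hhnonneg φ φt hfpos hgpos η hη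
        beta_reduce
        rw [hconv η hη, Real.norm_eq_abs, abs_of_nonneg b1]
        linarith)
    have o2 : (fun η => mellinH φ φt (exp η)) =O[atTop] fun η => mellinConv φ φt (exp η) :=
      .of_norm_eventuallyLE (hev.mono fun η hη => by
        have b1 := hhnonneg φt φ hgpos hfpos η hη
        have b2 := hhnonneg φ φt hfpos hgpos η hη
        beta_reduce
        rw [hconv η hη, Real.norm_eq_abs, abs_of_nonneg b2]
        linarith)
    refine IsLittleO.const_mul_right hc.ne' (((k1.trans_isBigO o1).add
      (k2.trans_isBigO o2)).congr' (hev.mono fun η hη => ?_) .rfl)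
    beta_reduce
    rw [hadd η hη, hconv η hη]
    ring
  refine ⟨?_, ?_, ?_⟩
  · rw [← map_exp_atTop, isLittleO_map]; exact k1
  · rw [← map_exp_atTop, isLittleO_map]; exact k2
  · rw [IsEquivalent, ← map_exp_atTop, isLittleO_map]; exact k3
end
end
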